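/- arXiv:1505.06748 — 3 statements merged into one kernel-verified Lean document; each statement's English description precedes it below -/
import Mathlib

section
/- For every K < 0, every C > 0, and every z₀ ∈ ∂𝔻, there exists a smooth convex function f : ℝ² → ℝ with ‖∇f(p)‖ < 1 for all p ∈ ℝ² and det D²f(p) = |K|·(1−‖∇f(p)‖²)² for all p (so the graph of f is a spacelike entire graph of constant curvature K), such that lim_{r→+∞}(r − f(rz)) = 0 for every z ∈ ∂𝔻 with z ≠ z₀, while lim_{r→+∞}(r − f(rz₀)) = −√C. -/
open Metric Filter
open scoped RealInnerProductSpace Topology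

noncomputable section

/-- The plane `ℝ²`, as a Euclidean space. -/
abbrev E2 : Type := EuclideanSpace ℝ (Fin 2)

/-- The Hessian of `f : ℝ² → ℝ` at `p`, evaluated as a bilinear form on `(v, w)`. -/
def hess (f : E2 → ℝ) (p v w : E2) : ℝ := fderiv ℝ (fderiv ℝ f) p v w

/-- The determinant of the Hessian of `f : ℝ² → ℝ` at `p`. -/
def detHess (f : E2 → ℝ) (p : E2) : ℝ :=
  hess f p (EuclideanSpace.single 0 1) (EuclideanSpace.single 0 1) *
    hess f p (EuclideanSpace.single 1 1) (EuclideanSpace.single 1 1) -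
  hess f p (EuclideanSpace.single 0 1) (EuclideanSpace.single 1 1) *
    hess f p (EuclideanSpace.single 1 1) (EuclideanSpace.single 0 1)

/-- The profile function `g`. -/
def gB (L c u : ℝ) : ℝ := (1 / (2 * L * c)) * (Real.log (u + c) - Real.log (u - c))

/-- The implicit equation is `HB L c u y = 2 x`. -/
def HB (L c u y : ℝ) : ℝ := y ^ 2 / u + gB L c u - u

lemma gB_hasDerivAt {L c u : ℝ} (hL : 0 < L) (hc : 0 < c) (hu : c < u) :
    HasDerivAt (gB L c) (-1 / (L * (u ^ 2 - c ^ 2))) u := by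
  have h1 : u + c ≠ 0 := by linarith
  have h2 : u - c ≠ 0 := by linarith
  have h3 : u ^ 2 - c ^ 2 ≠ 0 := by
    rw [sq_sub_sq]; exact mul_ne_zero h1 h2
  have := ((((hasDerivAt_id u).add_const c).log h1).sub
    (((hasDerivAt_id u).sub_const c).log h2)).const_mul (1 / (2 * L * c))
  refine this.congr_deriv ?_
  simp only [id]
  rw [sq_sub_sq]
  field_simp
  ring

lemma gB_antitone {L c u v : ℝ} (hL : 0 < L) (hc : 0 < c) (hu : c < u) (huv : u ≤ v) :
    gB L c v ≤ gB L c u := by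
  unfold gB
  apply mul_le_mul_of_nonneg_left _ (by positivity)
  have h : Real.log ((v + c) * (u - c)) ≤ Real.log ((u + c) * (v - c)) := by
    apply Real.log_le_log
    · exact mul_pos (by linarith) (by linarith)
    · nlinarith
  rw [Real.log_mul (by linarith) (by linarith), Real.log_mul (by linarith) (by linarith)] at h
  linarith

lemma gB_nonneg {L c u : ℝ} (hL : 0 < L) (hc : 0 < c) (hu : c < u) : 0 ≤ gB L c u := by
  unfold gB
  apply mul_nonneg (by positivity)
  have : Real.log (u - c) ≤ Real.log (u + c) := Real.log_le_log (by linarith) (by linarith)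
  linarith

lemma gB_tendsto {L c : ℝ} (hc : 0 < c) : Tendsto (gB L c) atTop (𝓝 0) := by
  have h1 : Tendsto (fun u : ℝ => (u + c) / (u - c)) atTop (𝓝 1) := by
    have h : Tendsto (fun u : ℝ => 1 + (2 * c) / (u - c)) atTop (𝓝 (1 + 0)) :=
      tendsto_const_nhds.add (tendsto_const_nhds.div_atTop
        (tendsto_atTop_add_const_right _ (-c) tendsto_id))
    rw [add_zero] at h
    refine h.congr' ?_
    filter_upwards [eventually_gt_atTop c] with u hu
    have : u - c ≠ 0 := by linarith
    field_simp
    ring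
  have h2 := ((Real.continuousAt_log one_ne_zero).tendsto.comp h1).const_mul (1 / (2 * L * c))
  rw [Real.log_one, mul_zero] at h2
  refine h2.congr' ?_
  filter_upwards [eventually_gt_atTop c] with u hu
  simp only [Function.comp, gB]
  rw [Real.log_div (by linarith) (by linarith)]

lemma gB_convex {L c : ℝ} (hL : 0 < L) (hc : 0 < c) : ConvexOn ℝ (Set.Ioi c) (gB L c) := by
  apply MonotoneOn.convexOn_of_deriv (convex_Ioi c)
  · intro u hu
    exact (gB_hasDerivAt hL hc hu).continuousAt.continuousWithinAt
  · rw [interior_Ioi]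
    intro u hu
    exact (gB_hasDerivAt hL hc hu).differentiableAt.differentiableWithinAt
  · rw [interior_Ioi]
    intro u hu v hv huv
    rw [(gB_hasDerivAt hL hc hu).deriv, (gB_hasDerivAt hL hc hv).deriv]
    simp only [Set.mem_Ioi] at hu hv
    rw [neg_div, neg_div, neg_le_neg_iff]
    apply one_div_le_one_div_of_le
    · apply mul_pos hL; nlinarith
    · apply mul_le_mul_of_nonneg_left _ hL.le
      nlinarith

lemma HB_decr {L c u v : ℝ} (y : ℝ) (hL : 0 < L) (hc : 0 < c) (hu : c < u) (huv : u ≤ v) :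
    v - u ≤ HB L c u y - HB L c v y := by
  have h1 := gB_antitone hL hc hu huv
  have h2 : y ^ 2 / v ≤ y ^ 2 / u :=
    div_le_div_of_nonneg_left (sq_nonneg y) (hc.trans hu) huv
  unfold HB
  linarith

lemma HB_le_imp {L c u v y : ℝ} (hL : 0 < L) (hc : 0 < c) (hu : c < u) (hv : c < v)
    (h : HB L c u y ≤ HB L c v y) : v ≤ u := by
  by_contra hlt
  push Not at hlt
  have := HB_decr y hL hc hu hlt.le
  linarith

lemma HB_exists {L c : ℝ} (hL : 0 < L) (hc : 0 < c) (y t : ℝ) :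
    ∃ u, c < u ∧ HB L c u y = t := by
  obtain ⟨u₁, h₁, h₁', ht₁⟩ : ∃ u, c < u ∧ u ≤ c + 1 ∧ t ≤ HB L c u y := by
    set e := min 1 (2 * c * Real.exp (-(2 * L * c * (t + c + 1)))) with he
    have he0 : 0 < e := lt_min one_pos (by positivity)
    have he1 : e ≤ 1 := min_le_left _ _
    refine ⟨c + e, by linarith, by linarith, ?_⟩
    have h1 : Real.log e ≤ Real.log (2 * c) + (-(2 * L * c * (t + c + 1))) := by
      rw [← Real.log_exp (-(2 * L * c * (t + c + 1))), ← Real.log_mul (by positivity)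
        (by positivity)]
      exact Real.log_le_log he0 (min_le_right _ _)
    have h2 : Real.log (2 * c) ≤ Real.log (c + e + c) :=
      Real.log_le_log (by positivity) (by linarith)
    have h3 : t + c + 1 ≤ gB L c (c + e) := by
      unfold gB
      rw [add_sub_cancel_left, one_div, ← div_eq_inv_mul, le_div_iff₀ (by positivity)]
      linarith
    have h4 : 0 ≤ y ^ 2 / (c + e) := by positivity
    unfold HB
    linarith
  set u₂ := u₁ + (HB L c u₁ y - t) with hu₂
  have h12 : u₁ ≤ u₂ := by linarith
  have ht₂ : HB L c u₂ y ≤ t := by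
    have := HB_decr y hL hc h₁ h12
    linarith
  have hcont : ContinuousOn (fun u => HB L c u y) (Set.Icc u₁ u₂) := by
    intro u hu
    have hcu : c < u := lt_of_lt_of_le h₁ hu.1
    have := (gB_hasDerivAt hL hc hcu).continuousAt
    have hne : u ≠ 0 := by linarith
    apply ContinuousAt.continuousWithinAt
    unfold HB
    exact ((continuousAt_const.div continuousAt_id hne).add this).sub continuousAt_id
  obtain ⟨u, hu, hut⟩ := intermediate_value_Icc' h12 hcont ⟨ht₂, ht₁⟩
  exact ⟨u, lt_of_lt_of_le h₁ hu.1, hut⟩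

lemma HB_convex {L c u v y z s t : ℝ} (hL : 0 < L) (hc : 0 < c) (hu : c < u) (hv : c < v)
    (hs : 0 ≤ s) (ht : 0 ≤ t) (hst : s + t = 1) :
    HB L c (s * u + t * v) (s * y + t * z) ≤ s * HB L c u y + t * HB L c v z := by
  have h1 := (gB_convex hL hc).2 hu hv hs ht hst
  simp only [smul_eq_mul] at h1
  have hw : c < s * u + t * v := (convex_Ioi c) hu hv hs ht hst
  have key : ∀ m x r : ℝ, 0 < r → 2 * m * x - m ^ 2 * r ≤ x ^ 2 / r := by
    intro m x r hr
    rw [le_div_iff₀ hr]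
    nlinarith [sq_nonneg (x - m * r)]
  set m := (s * y + t * z) / (s * u + t * v) with hm
  have k1 := mul_le_mul_of_nonneg_left (key m y u (hc.trans hu)) hs
  have k2 := mul_le_mul_of_nonneg_left (key m z v (hc.trans hv)) ht
  have k3 : (s * y + t * z) ^ 2 / (s * u + t * v)
      = 2 * m * (s * y + t * z) - m ^ 2 * (s * u + t * v) := by
    have : s * u + t * v ≠ 0 := by linarith
    rw [hm]; field_simp; ring
  unfold HB
  rw [k3]
  linarith

/-- `∂H/∂u`. -/
def HuB (L c u y : ℝ) : ℝ := -y ^ 2 / u ^ 2 - 1 / (L * (u ^ 2 - c ^ 2)) - 1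

lemma HuB_neg {L c u y : ℝ} (hL : 0 < L) (hc : 0 < c) (hu : c < u) : HuB L c u y < 0 := by
  have h1 : 0 ≤ y ^ 2 / u ^ 2 := by positivity
  have h2 : 0 < u ^ 2 - c ^ 2 := by nlinarith
  have h3 : 0 < 1 / (L * (u ^ 2 - c ^ 2)) := by positivity
  unfold HuB
  rw [neg_div]
  linarith

section implicit

variable {E : Type*} [NormedAddCommGroup E] [NormedSpace ℝ E] [CompleteSpace E]

lemma HB_hasFDerivAt {L c : ℝ} (hL : 0 < L) (hc : 0 < c) {U Y : E → ℝ} {U' Y' : E →L[ℝ] ℝ} {p : E}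
    (hU : HasFDerivAt U U' p) (hY : HasFDerivAt Y Y' p) (h : c < U p) :
    HasFDerivAt (fun q => HB L c (U q) (Y q))
      (HuB L c (U p) (Y p) • U' + (2 * Y p / U p) • Y') p := by
  have hne : U p ≠ 0 := by linarith
  have hs : U p ^ 2 - c ^ 2 ≠ 0 := by nlinarith
  have h1 := (gB_hasDerivAt hL hc h).comp_hasFDerivAt p hU
  have h2 := (hasDerivAt_inv hne).comp_hasFDerivAt p hU
  have h3 := (((hY.pow 2).mul h2).add h1).sub hU
  refine (h3.congr_fderiv ?_).congr_of_eventuallyEq ?_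
  · ext v
    simp [HuB]
    field_simp
    ring
  · exact Eventually.of_forall fun q => by simp [HB, div_eq_mul_inv]

lemma U_contDiff {L c : ℝ} (hL : 0 < L) (hc : 0 < c) (X Y : E →L[ℝ] ℝ) (U : E → ℝ)
    (hU : ∀ p, c < U p) (hH : ∀ p, HB L c (U p) (Y p) = 2 * X p) :
    ContDiff ℝ (⊤ : ℕ∞) U := by
  rw [contDiff_iff_contDiffAt]
  intro p
  let F : E × ℝ → ℝ := fun q => HB L c q.2 (Y q.1) - 2 * X q.1
  have hne : U p ≠ 0 := by linarith [hU p]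
  have cdf : ContDiffAt ℝ (⊤ : ℕ∞) F (p, U p) := by
    have a1 : U p + c ≠ 0 := by linarith [hU p]
    have a2 : U p - c ≠ 0 := by linarith [hU p]
    simp only [F, HB, gB]
    have e1 : ContDiffAt ℝ (⊤ : ℕ∞) (fun q : E × ℝ => Real.log (q.2 + c)) (p, U p) :=
      (contDiffAt_snd.add contDiffAt_const).log a1
    have e2 : ContDiffAt ℝ (⊤ : ℕ∞) (fun q : E × ℝ => Real.log (q.2 - c)) (p, U p) :=
      (contDiffAt_snd.sub contDiffAt_const).log a2
    have e3 : ContDiffAt ℝ (⊤ : ℕ∞) (fun q : E × ℝ => Y q.1) (p, U p) :=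
      Y.contDiff.contDiffAt.comp _ contDiffAt_fst
    have e4 : ContDiffAt ℝ (⊤ : ℕ∞) (fun q : E × ℝ => X q.1) (p, U p) :=
      X.contDiff.contDiffAt.comp _ contDiffAt_fst
    exact ((((e3.pow 2).div contDiffAt_snd hne).add
      (contDiffAt_const.mul (e1.sub e2))).sub contDiffAt_snd).sub (contDiffAt_const.mul e4)
  have hF : HasFDerivAt F (HuB L c (U p) (Y p) • ContinuousLinearMap.snd ℝ E ℝ +
      (2 * Y p / U p) • (Y ∘L ContinuousLinearMap.fst ℝ E ℝ)
      - (2 : ℝ) • (X ∘L ContinuousLinearMap.fst ℝ E ℝ)) (p, U p) := by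
    have e1 := HB_hasFDerivAt (E := E × ℝ) (p := (p, U p)) (U := Prod.snd) (Y := fun q => Y q.1)
      hL hc hasFDerivAt_snd (Y.hasFDerivAt.comp _ hasFDerivAt_fst) (hU p)
    exact e1.sub ((X.hasFDerivAt.comp _ hasFDerivAt_fst).const_mul 2)
  have hA := HuB_neg (y := Y p) hL hc (hU p)
  have if₂ : (fderiv ℝ F (p, U p) ∘L .inr ℝ E ℝ).IsInvertible := by
    rw [hF.fderiv]
    refine ⟨ContinuousLinearEquiv.unitsEquivAut ℝ (Units.mk0 _ hA.ne), ?_⟩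
    ext
    simp
  have pn : ((⊤ : ℕ∞) : WithTop ℕ∞) ≠ 0 := by simp
  have hcd := cdf.contDiffAt_implicitFunction pn if₂
  refine hcd.congr_of_eventuallyEq ?_
  have t1 := hcd.continuousAt.tendsto
  rw [cdf.implicitFunction_apply_self pn if₂] at t1
  filter_upwards [cdf.eventually_apply_implicitFunction pn if₂, t1.eventually (lt_mem_nhds (hU p))]
    with q hq1 hq2
  have hq3 : HB L c (cdf.implicitFunction pn if₂ q) (Y q) = HB L c (U q) (Y q) := by
    have := hH p
    have := hH q
    simp only [F] at hq1
    linarith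
  exact le_antisymm (HB_le_imp hL hc hq2 (hU q) hq3.le) (HB_le_imp hL hc (hU q) hq2 hq3.ge)

lemma U_hasFDerivAt {L c : ℝ} (hL : 0 < L) (hc : 0 < c) (X Y : E →L[ℝ] ℝ) (U : E → ℝ)
    (hU : ∀ p, c < U p) (hH : ∀ p, HB L c (U p) (Y p) = 2 * X p) (p : E) :
    HasFDerivAt U ((2 / HuB L c (U p) (Y p)) • X
      + (-(2 * Y p / U p) / HuB L c (U p) (Y p)) • Y) p := by
  have hd := ((U_contDiff hL hc X Y U hU hH).differentiable (by simp) p).hasFDerivAt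
  have h1 := HB_hasFDerivAt hL hc hd Y.hasFDerivAt (hU p)
  have h2 : HasFDerivAt (fun q => HB L c (U q) (Y q)) ((2 : ℝ) • X) p := by
    have : (fun q => HB L c (U q) (Y q)) = fun q => 2 * X q := funext hH
    rw [this]
    exact X.hasFDerivAt.const_mul 2
  have h3 := h1.unique h2
  have hA := (HuB_neg (y := Y p) hL hc (hU p)).ne
  refine hd.congr_fderiv ?_
  ext v
  have h4 := congrArg (fun T : E →L[ℝ] ℝ => T v) h3
  simp at h4 ⊢
  have hne : U p ≠ 0 := by linarith [hU p]
  have h5 : (fderiv ℝ U p) v = (2 * X v - 2 * Y p / U p * Y v) / HuB L c (U p) (Y p) := by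
    rw [eq_div_iff hA]
    linarith
  rw [h5]
  ring

lemma line_deriv_clm (G : E → E →L[ℝ] ℝ) (p v w : E) (hG : DifferentiableAt ℝ G p) :
    HasDerivAt (fun t : ℝ => G (p + t • v) w) (fderiv ℝ G p v w) 0 := by
  have hline : HasDerivAt (fun t : ℝ => p + t • v) v 0 := by
    simpa using ((hasDerivAt_id (0 : ℝ)).smul_const v).const_add p
  have hh : HasFDerivAt G (fderiv ℝ G p) (p + (0 : ℝ) • v) := by
    simpa using hG.hasFDerivAt
  have h1 : HasDerivAt (fun t : ℝ => G (p + t • v)) (fderiv ℝ G p v) 0 :=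
    hh.comp_hasDerivAt (0 : ℝ) hline
  have h2 := h1.clm_apply (hasDerivAt_const (0 : ℝ) w)
  simpa using h2

/-- `f = U + X`; second derivative along lines. -/
lemma hess_formula {L c : ℝ} (hL : 0 < L) (hc : 0 < c) (X Y : E →L[ℝ] ℝ) (U : E → ℝ)
    (hU : ∀ p, c < U p) (hH : ∀ p, HB L c (U p) (Y p) = 2 * X p) (p : E) (v w : E) :
    ∃ ud Ad : ℝ, ud = (2 / HuB L c (U p) (Y p)) * X v
        + (-(2 * Y p / U p) / HuB L c (U p) (Y p)) * Y v ∧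
      Ad = (2 * Y p ^ 2 / U p ^ 3 + 2 * U p / (L * (U p ^ 2 - c ^ 2) ^ 2)) * ud
        - 2 * Y p / U p ^ 2 * Y v ∧
      fderiv ℝ (fderiv ℝ (fun q => U q + X q)) p v w =
        -2 * Ad / HuB L c (U p) (Y p) ^ 2 * X w +
        ((-(2 * Y v / U p) + 2 * Y p * ud / U p ^ 2) / HuB L c (U p) (Y p)
          + (2 * Y p / U p) * Ad / HuB L c (U p) (Y p) ^ 2) * Y w := by
  refine ⟨_, _, rfl, rfl, ?_⟩
  set ud := (2 / HuB L c (U p) (Y p)) * X v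
        + (-(2 * Y p / U p) / HuB L c (U p) (Y p)) * Y v with hud
  set Ad := (2 * Y p ^ 2 / U p ^ 3 + 2 * U p / (L * (U p ^ 2 - c ^ 2) ^ 2)) * ud
        - 2 * Y p / U p ^ 2 * Y v with hAd
  have hcd : ContDiff ℝ (⊤ : ℕ∞) (fun q => U q + X q) :=
    (U_contDiff hL hc X Y U hU hH).add X.contDiff
  have hfd : fderiv ℝ (fun q => U q + X q) = fun q => (2 / HuB L c (U q) (Y q)) • X
      + (-(2 * Y q / U q) / HuB L c (U q) (Y q)) • Y + X :=
    funext fun q => ((U_hasFDerivAt hL hc X Y U hU hH q).add X.hasFDerivAt).fderiv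
  have hdd : DifferentiableAt ℝ (fderiv ℝ (fun q => U q + X q)) p :=
    (hcd.fderiv_right (m := (1 : ℕ∞)) (by exact_mod_cast (le_top : (1 + 1 : ℕ∞) ≤ ⊤))).differentiable
      (by simp) p
  -- the line
  have hline : HasDerivAt (fun t : ℝ => p + t • v) v 0 := by
    simpa using ((hasDerivAt_id (0 : ℝ)).smul_const v).const_add p
  have e1 : HasDerivAt (fun t : ℝ => fderiv ℝ (fun q => U q + X q) (p + t • v) w)
      (fderiv ℝ (fderiv ℝ (fun q => U q + X q)) p v w) 0 :=
    line_deriv_clm _ p v w hdd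
  have hu : HasDerivAt (fun t : ℝ => U (p + t • v)) ud 0 := by
    have hh := U_hasFDerivAt hL hc X Y U hU hH (p + (0 : ℝ) • v)
    have := hh.comp_hasDerivAt (0 : ℝ) hline
    refine this.congr_deriv ?_
    simp [hud]
  have hy : HasDerivAt (fun t : ℝ => Y (p + t • v)) (Y v) 0 :=
    Y.hasFDerivAt.comp_hasDerivAt (0 : ℝ) hline
  have hp0 : p + (0 : ℝ) • v = p := by simp
  have hu0 : U (p + (0 : ℝ) • v) ≠ 0 := by linarith [hU (p + (0 : ℝ) • v)]
  have hs0 : L * (U (p + (0 : ℝ) • v) ^ 2 - c ^ 2) ≠ 0 := by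
    have := hU (p + (0 : ℝ) • v)
    have : 0 < U (p + (0 : ℝ) • v) ^ 2 - c ^ 2 := by nlinarith
    positivity
  have hA0 := (HuB_neg (y := Y (p + (0 : ℝ) • v)) hL hc (hU (p + (0 : ℝ) • v))).ne
  have hA : HasDerivAt (fun t : ℝ => HuB L c (U (p + t • v)) (Y (p + t • v))) Ad 0 := by
    have := (((hy.pow 2).neg.div (hu.pow 2) (pow_ne_zero 2 hu0)).sub
      ((hasDerivAt_const (0 : ℝ) (1 : ℝ)).div (((hu.pow 2).sub_const (c ^ 2)).const_mul L) hs0)).sub_const 1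
    refine (this.congr_deriv ?_).congr_of_eventuallyEq ?_
    · simp only [Pi.pow_apply, Pi.neg_apply, hp0] at hu0 hs0 ⊢
      have hs1 : U p ^ 2 - c ^ 2 ≠ 0 := right_ne_zero_of_mul hs0
      clear_value ud
      rw [hAd]
      field_simp
      ring
    · exact Eventually.of_forall fun t => by simp [HuB]
  have e2 : HasDerivAt (fun t : ℝ => fderiv ℝ (fun q => U q + X q) (p + t • v) w)
      (-2 * Ad / HuB L c (U p) (Y p) ^ 2 * X w +
        ((-(2 * Y v / U p) + 2 * Y p * ud / U p ^ 2) / HuB L c (U p) (Y p)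
          + (2 * Y p / U p) * Ad / HuB L c (U p) (Y p) ^ 2) * Y w) 0 := by
    have := (((((hasDerivAt_const (0 : ℝ) (2 : ℝ)).div hA hA0).mul_const (X w)).add
      ((((hy.const_mul 2).div hu hu0).neg.div hA hA0).mul_const (Y w))).add_const (X w))
    refine (this.congr_deriv ?_).congr_of_eventuallyEq ?_
    · simp only [Pi.div_apply, Pi.neg_apply, hp0] at hu0 hA0 ⊢
      clear_value Ad ud
      generalize HuB L c (U p) (Y p) = A at *
      field_simp
      ring
    · exact Eventually.of_forall fun t => by simp [hfd]
  exact e1.unique e2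

end implicit

/-- **Proposition A (parabolic-invariant barriers).** For every `K < 0`, `C > 0` and unit
vector `z₀ ∈ ∂𝔻`, there is a spacelike entire graph of constant curvature `K` whose support
function at infinity vanishes on `∂𝔻 \ {z₀}` and equals `−√C` at `z₀`. -/
theorem parabolic_invariant_barrier
    (K C : ℝ) (hK : K < 0) (hC : 0 < C)
    (z₀ : E2) (hz₀ : z₀ ∈ sphere (0 : E2) 1) :
    ∃ f : E2 → ℝ,
      ContDiff ℝ (⊤ : ℕ∞) f ∧ ConvexOn ℝ Set.univ f ∧
      (∀ p : E2, ‖gradient f p‖ < 1) ∧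
      (∀ p : E2, detHess f p = |K| * (1 - ‖gradient f p‖ ^ 2) ^ 2) ∧
      (∀ z ∈ sphere (0 : E2) 1, z ≠ z₀ →
        Tendsto (fun r : ℝ => r - f (r • z)) atTop (𝓝 (0 : ℝ))) ∧
      Tendsto (fun r : ℝ => r - f (r • z₀)) atTop (𝓝 (-Real.sqrt C)) := by
  have hL : 0 < |K| := abs_pos.mpr hK.ne
  set L := |K| with hLdef
  set c := Real.sqrt C with hcdef
  have hc : 0 < c := Real.sqrt_pos.mpr hC
  have hn : z₀ 0 ^ 2 + z₀ 1 ^ 2 = 1 := by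
    have h : ‖z₀‖ = 1 := by simpa using hz₀
    have h2 := EuclideanSpace.norm_sq_eq z₀
    rw [h] at h2
    simp at h2
    linarith
  let z₁ : E2 := !₂[-z₀ 1, z₀ 0]
  let X : E2 →L[ℝ] ℝ := innerSL ℝ z₀
  let Y : E2 →L[ℝ] ℝ := innerSL ℝ z₁
  have hX : ∀ p : E2, X p = z₀ 0 * p 0 + z₀ 1 * p 1 := by
    intro p
    simp [X, PiLp.inner_apply, Fin.sum_univ_two, mul_comm]
  have hY : ∀ p : E2, Y p = -z₀ 1 * p 0 + z₀ 0 * p 1 := by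
    intro p
    simp [Y, z₁, PiLp.inner_apply, Fin.sum_univ_two, mul_comm]
  choose U hU hH using fun p : E2 => HB_exists hL hc (Y p) (2 * X p)
  have hder : ∀ p, HasFDerivAt (fun q => U q + X q) _ p := fun p =>
    (U_hasFDerivAt hL hc X Y U hU hH p).add X.hasFDerivAt
  have hgrad : ∀ p, ‖gradient (fun q => U q + X q) p‖ ^ 2 =
      (2 / HuB L c (U p) (Y p) + 1) ^ 2
        + (-(2 * Y p / U p) / HuB L c (U p) (Y p)) ^ 2 := by
    intro p
    have : gradient (fun q => U q + X q) p = (2 / HuB L c (U p) (Y p) + 1) • z₀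
        + (-(2 * Y p / U p) / HuB L c (U p) (Y p)) • z₁ := by
      apply HasGradientAt.gradient
      rw [hasGradientAt_iff_hasFDerivAt]
      refine (hder p).congr_fderiv ?_
      ext v
      simp only [X, Y, add_apply, smul_apply,
        innerSL_apply_apply, InnerProductSpace.toDual_apply_apply, inner_add_left,
        real_inner_smul_left, smul_eq_mul]
      ring
    rw [this, EuclideanSpace.norm_sq_eq]
    generalize 2 / HuB L c (U p) (Y p) + 1 = P
    generalize -(2 * Y p / U p) / HuB L c (U p) (Y p) = Q
    simp [Fin.sum_univ_two, z₁]
    linear_combination (P ^ 2 + Q ^ 2) * hn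
  have hone : ∀ p, 1 - ‖gradient (fun q => U q + X q) p‖ ^ 2 =
      4 / (L * (U p ^ 2 - c ^ 2)) / HuB L c (U p) (Y p) ^ 2 := by
    intro p
    rw [hgrad]
    have hA := (HuB_neg (y := Y p) hL hc (hU p)).ne
    have hs : U p ^ 2 - c ^ 2 ≠ 0 := by nlinarith [hU p]
    have hu : U p ≠ 0 := by linarith [hU p]
    have hAe : 1 / (L * (U p ^ 2 - c ^ 2))
        = -HuB L c (U p) (Y p) - 1 - Y p ^ 2 / U p ^ 2 := by
      unfold HuB; ring
    have : 4 / (L * (U p ^ 2 - c ^ 2)) = 4 * (1 / (L * (U p ^ 2 - c ^ 2))) := by ring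
    rw [this, hAe]
    generalize HuB L c (U p) (Y p) = A at *
    field_simp
    ring
  have hspos : ∀ p, 0 < U p ^ 2 - c ^ 2 := fun p => by nlinarith [hU p]
  refine ⟨fun q => U q + X q, ?_, ?_, ?_, ?_, ?_, ?_⟩
  · exact (U_contDiff hL hc X Y U hU hH).add X.contDiff
  · refine ⟨convex_univ, ?_⟩
    intro p _ q _ s t hs ht hst
    have h1 := HB_convex (y := Y p) (z := Y q) hL hc (hU p) (hU q) hs ht hst
    have h2 : c < s * U p + t * U q := (convex_Ioi c) (hU p) (hU q) hs ht hst
    have h3 : U (s • p + t • q) ≤ s * U p + t * U q := by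
      apply HB_le_imp (y := Y (s • p + t • q)) hL hc h2 (hU _)
      rw [hH (s • p + t • q)]
      rw [hH, hH] at h1
      simp only [map_add, map_smul, smul_eq_mul]
      linarith
    simp only [map_add, map_smul, smul_eq_mul]
    linarith
  · intro p
    have h1 := hone p
    have hA := HuB_neg (y := Y p) hL hc (hU p)
    have h2 : 0 < 4 / (L * (U p ^ 2 - c ^ 2)) / HuB L c (U p) (Y p) ^ 2 := by
      have := hspos p
      have := sq_pos_of_neg hA
      positivity
    have h3 := norm_nonneg (gradient (fun q => U q + X q) p)
    nlinarith
  · intro p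
    rw [hone p]
    unfold detHess hess
    obtain ⟨u1, A1, hu1, hA1, h00⟩ := hess_formula hL hc X Y U hU hH p
      (EuclideanSpace.single 0 1) (EuclideanSpace.single 0 1)
    obtain ⟨u2, A2, hu2, hA2, h11⟩ := hess_formula hL hc X Y U hU hH p
      (EuclideanSpace.single 1 1) (EuclideanSpace.single 1 1)
    obtain ⟨u3, A3, hu3, hA3, h01⟩ := hess_formula hL hc X Y U hU hH p
      (EuclideanSpace.single 0 1) (EuclideanSpace.single 1 1)
    obtain ⟨u4, A4, hu4, hA4, h10⟩ := hess_formula hL hc X Y U hU hH p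
      (EuclideanSpace.single 1 1) (EuclideanSpace.single 0 1)
    rw [h00, h11, h01, h10]
    obtain rfl : u3 = u1 := hu3.trans hu1.symm
    obtain rfl : u4 = u2 := hu4.trans hu2.symm
    obtain rfl : A3 = A1 := hA3.trans hA1.symm
    obtain rfl : A4 = A2 := hA4.trans hA2.symm
    have x0 : X (EuclideanSpace.single 0 1) = z₀ 0 := by simp [hX]
    have x1 : X (EuclideanSpace.single 1 1) = z₀ 1 := by simp [hX]
    have y0 : Y (EuclideanSpace.single 0 1) = -z₀ 1 := by simp [hY]
    have y1 : Y (EuclideanSpace.single 1 1) = z₀ 0 := by simp [hY]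
    rw [x0, y0] at hu1
    rw [x1, y1] at hu2
    rw [y0] at hA1
    rw [y1] at hA2
    rw [x0, x1, y0, y1]
    have hA := (HuB_neg (y := Y p) hL hc (hU p)).ne
    have hs := (hspos p).ne'
    have hu : U p ≠ 0 := by linarith [hU p]
    clear h00 h11 h01 h10 hu3 hu4 hA3 hA4 x0 x1 y0 y1 hone hgrad hder
    generalize HuB L c (U p) (Y p) = A at *
    generalize Y p = y at *
    generalize U p = u at *
    generalize z₀ 0 = a at *
    generalize z₀ 1 = b at *
    generalize hS : u ^ 2 - c ^ 2 = S at *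
    have key : (-2 * A3 / A ^ 2 * a + ((-(2 * -b / u) + 2 * y * u3 / u ^ 2) / A
          + 2 * y / u * A3 / A ^ 2) * -b) *
        (-2 * A4 / A ^ 2 * b + ((-(2 * a / u) + 2 * y * u4 / u ^ 2) / A
          + 2 * y / u * A4 / A ^ 2) * a) -
        (-2 * A3 / A ^ 2 * b + ((-(2 * -b / u) + 2 * y * u3 / u ^ 2) / A
          + 2 * y / u * A3 / A ^ 2) * a) *
        (-2 * A4 / A ^ 2 * a + ((-(2 * a / u) + 2 * y * u4 / u ^ 2) / A
          + 2 * y / u * A4 / A ^ 2) * -b) = (a ^ 2 + b ^ 2) ^ 2 *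
          (L * (4 / (L * S) / A ^ 2) ^ 2) := by
      rw [hA1, hA2, hu1, hu2]
      field_simp
      ring
    rw [key, hn]
    ring
  · intro z hz hzz
    have hzn : z 0 ^ 2 + z 1 ^ 2 = 1 := by
      have h : ‖z‖ = 1 := by simpa using hz
      have h2 := EuclideanSpace.norm_sq_eq z
      rw [h] at h2
      simp at h2
      linarith
    have hxy : X z ^ 2 + Y z ^ 2 = 1 := by
      rw [hX, hY]
      linear_combination (z 0 ^ 2 + z 1 ^ 2) * hn + hzn
    have hx1 : X z < 1 := by
      by_contra hge
      push Not at hge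
      apply hzz
      have e : (z 0 - z₀ 0) ^ 2 + (z 1 - z₀ 1) ^ 2 ≤ 0 := by
        rw [hX] at hge
        nlinarith
      ext i
      fin_cases i
      · simp only [Fin.zero_eta]
        nlinarith [sq_nonneg (z 0 - z₀ 0), sq_nonneg (z 1 - z₀ 1)]
      · simp only [Fin.mk_one]
        nlinarith [sq_nonneg (z 0 - z₀ 0), sq_nonneg (z 1 - z₀ 1)]
    have hw : Tendsto (fun r : ℝ => r * (1 - X z)) atTop atTop :=
      tendsto_id.atTop_mul_const (by linarith)
    have hg := ((gB_tendsto (L := L) hc).comp hw).neg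
    rw [neg_zero] at hg
    refine tendsto_of_tendsto_of_tendsto_of_le_of_le' hg tendsto_const_nhds ?_ ?_
    all_goals
      filter_upwards [hw.eventually_gt_atTop c, eventually_gt_atTop 0] with r hr hr0
      have hx2 : 1 - X z ≠ 0 := by linarith
      have hval : HB L c (r * (1 - X z)) (Y (r • z)) = 2 * X (r • z) + gB L c (r * (1 - X z)) := by
        have : (r * Y z) ^ 2 / (r * (1 - X z)) = r * (1 + X z) := by
          rw [div_eq_iff (by positivity)]
          linear_combination r ^ 2 * hxy
        unfold HB
        simp only [map_smul, smul_eq_mul]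
        rw [this]
        ring
      have hle : r * (1 - X z) ≤ U (r • z) := by
        apply HB_le_imp (y := Y (r • z)) hL hc (hU _) hr
        rw [hval, hH]
        linarith [gB_nonneg hL hc hr]
      have hdec := HB_decr (Y (r • z)) hL hc hr hle
      rw [hval, hH] at hdec
      simp only [map_smul, smul_eq_mul, Function.comp]
      linarith
  · have hx : X z₀ = 1 := by rw [hX]; linarith
    have hy : Y z₀ = 0 := by rw [hY]; ring
    have hlim : Tendsto (fun r : ℝ => U (r • z₀)) atTop (𝓝 c) := by
      rw [Metric.tendsto_nhds]
      intro e he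
      filter_upwards [eventually_ge_atTop (HB L c (c + e / 2) 0 / 2)] with r hr
      have h1 : U (r • z₀) ≤ c + e / 2 := by
        apply HB_le_imp (y := Y (r • z₀)) hL hc (by linarith) (hU _)
        rw [hH]
        simp only [map_smul, smul_eq_mul, hx, hy, mul_zero]
        linarith
      rw [Real.dist_eq, abs_lt]
      constructor <;> linarith [hU (r • z₀)]
    refine hlim.neg.congr ?_
    intro r
    simp only [map_smul, smul_eq_mul, hx]
    ring
end
end

section
/- Let φ : ∂𝔻 → ℝ be bounded and lower semicontinuous and let K₁ < K₂ < 0. Suppose f₁, f₂ : ℝ² → ℝ are smooth convex functions with ‖∇fᵢ(p)‖ < 1 for all p, det D²fᵢ(p) = |Kᵢ|·(1−‖∇fᵢ(p)‖²)² for all p ∈ ℝ², and lim_{r→+∞}(r − fᵢ(rz)) = φ(z) for every z ∈ ∂𝔻 (i = 1, 2). Then f₁(y) < f₂(y) for every y ∈ ℝ²; that is, the constant curvature surface of curvature K₂ is strictly in the future of the one of curvature K₁, and in particular the two graphs are disjoint. -/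
open Metric Filter
open scoped RealInnerProductSpace Topology

noncomputable section

lemma cmp_oneD (F G F1 G1 : ℝ → ℝ) (F2 G2 : ℝ)
    (hF : ∀ t, HasDerivAt F (F1 t) t) (hG : ∀ t, HasDerivAt G (G1 t) t)
    (hF1 : HasDerivAt F1 F2 0) (hG1 : HasDerivAt G1 G2 0)
    (hmax : ∀ t, F t - G t ≤ F 0 - G 0) : F1 0 = G1 0 ∧ F2 ≤ G2 := by
  have hd : ∀ t, HasDerivAt (fun t => F t - G t) (F1 t - G1 t) t := fun t => (hF t).sub (hG t)
  have hloc : IsLocalMax (fun t => F t - G t) 0 := Filter.Eventually.of_forall hmax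
  have h0 := hloc.hasDerivAt_eq_zero (hd 0)
  refine ⟨by linarith, ?_⟩
  by_contra hlt
  push Not at hlt
  have hder : deriv (fun t => F t - G t) = fun t => F1 t - G1 t := funext fun t => (hd t).deriv
  have hdd : deriv (deriv (fun t => F t - G t)) 0 = F2 - G2 := by
    rw [hder]; exact (hF1.sub hG1).deriv
  have hmin : IsLocalMin (fun t => F t - G t) 0 := by
    apply isLocalMin_of_deriv_deriv_pos
    · rw [hdd]; linarith
    · rw [hder]; exact h0
    · exact (hd 0).continuousAt
  have hc : (fun t => F t - G t) =ᶠ[𝓝 0] fun _ => F 0 - G 0 := by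
    filter_upwards [hmin] with t ht
    exact le_antisymm (hmax t) ht
  have h3 := hc.deriv.deriv_eq
  rw [hdd] at h3
  simp at h3
  linarith

lemma line_deriv {f : E2 → ℝ} (hf : ContDiff ℝ (⊤ : ℕ∞) f) (q v : E2) (t : ℝ) :
    HasDerivAt (fun t : ℝ => f (q + t • v)) (fderiv ℝ f (q + t • v) v) t := by
  have h1 : HasDerivAt (fun t : ℝ => q + t • v) v t := by
    simpa using ((hasDerivAt_id t).smul_const v).const_add q
  have h2 : HasFDerivAt f (fderiv ℝ f (q + t • v)) (q + t • v) :=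
    ((hf.differentiable (by simp)) _).hasFDerivAt
  exact h2.comp_hasDerivAt t h1

lemma line_deriv2 {f : E2 → ℝ} (hf : ContDiff ℝ (⊤ : ℕ∞) f) (q v : E2) :
    HasDerivAt (fun t : ℝ => fderiv ℝ f (q + t • v) v) (hess f q v v) 0 := by
  have h1 : HasDerivAt (fun t : ℝ => q + t • v) v 0 := by
    simpa using ((hasDerivAt_id (0 : ℝ)).smul_const v).const_add q
  have hd : Differentiable ℝ (fderiv ℝ f) :=
    (hf.fderiv_right (m := ((⊤ : ℕ∞) : WithTop ℕ∞)) (by simp)).differentiable (by simp)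
  have h2 : HasFDerivAt (fderiv ℝ f) (fderiv ℝ (fderiv ℝ f) q) (q + (0 : ℝ) • v) := by
    simpa using (hd q).hasFDerivAt
  have h3 := h2.comp_hasDerivAt (0 : ℝ) h1
  exact h3.clm_apply (hasDerivAt_const (0 : ℝ) v) |>.congr_deriv (by simp [hess])

lemma hess_symm {f : E2 → ℝ} (hf : ContDiff ℝ (⊤ : ℕ∞) f) (q v w : E2) :
    hess f q v w = hess f q w v := by
  have hd : Differentiable ℝ (fderiv ℝ f) :=
    (hf.fderiv_right (m := ((⊤ : ℕ∞) : WithTop ℕ∞)) (by simp)).differentiable (by simp)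
  exact second_derivative_symmetric (fun y => ((hf.differentiable (by simp)) y).hasFDerivAt)
    (hd q).hasFDerivAt v w

lemma hess_quad {f : E2 → ℝ} (hf : ContDiff ℝ (⊤ : ℕ∞) f) (q v w : E2) (x y : ℝ) :
    hess f q (x • v + y • w) (x • v + y • w) =
      hess f q v v * x ^ 2 + 2 * hess f q v w * x * y + hess f q w w * y ^ 2 := by
  have := hess_symm hf q v w
  simp only [hess] at *
  simp only [map_add, map_smul, add_apply, smul_apply,
    smul_eq_mul]
  rw [← this]; ring

lemma quad_det_nonneg {a b d : ℝ} (h : ∀ x y : ℝ, 0 ≤ a * x ^ 2 + 2 * b * x * y + d * y ^ 2) :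
    0 ≤ a ∧ 0 ≤ d ∧ b ^ 2 ≤ a * d := by
  have ha : 0 ≤ a := by simpa using h 1 0
  have hd : 0 ≤ d := by simpa using h 0 1
  refine ⟨ha, hd, ?_⟩
  rcases ha.eq_or_lt with h0 | h0
  · subst h0
    have h1 := h (-(d + 1)) b
    have h2 := h (d + 1) (-b)
    nlinarith [sq_nonneg b]
  · have h1 := h (-b) a
    have : 0 ≤ a * (a * d - b ^ 2) := by nlinarith
    have := nonneg_of_mul_nonneg_right this h0
    linarith

lemma det_mono {a b d α β γ : ℝ} (h : ∀ x y : ℝ, 0 ≤ a * x ^ 2 + 2 * b * x * y + d * y ^ 2)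
    (h' : ∀ x y : ℝ, a * x ^ 2 + 2 * b * x * y + d * y ^ 2 ≤
      α * x ^ 2 + 2 * β * x * y + γ * y ^ 2) : a * d - b * b ≤ α * γ - β * β := by
  obtain ⟨ha, hd, hb⟩ := quad_det_nonneg h
  obtain ⟨ha', hd', hb'⟩ := quad_det_nonneg (a := α - a) (b := β - b) (d := γ - d)
    (fun x y => by have := h' x y; nlinarith)
  have key : 2 * b * (β - b) ≤ a * (γ - d) + d * (α - a) := by
    refine abs_le_of_sq_le_sq' ?_ (by positivity) |>.2
    have := mul_le_mul hb hb' (sq_nonneg _) (by positivity)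
    nlinarith [sq_nonneg (a * (γ - d) - d * (α - a))]
  nlinarith

lemma fderiv_eq_inner {f : E2 → ℝ} (q v : E2) : fderiv ℝ f q v = ⟪gradient f q, v⟫ := by
  rw [← toDual_gradient]; simp

lemma tangent_le {f : E2 → ℝ} (hf : ContDiff ℝ (⊤ : ℕ∞) f) (hc : ConvexOn ℝ Set.univ f)
    (q x : E2) : f q + ⟪gradient f q, x - q⟫ ≤ f x := by
  have hconv : ConvexOn ℝ Set.univ (fun t : ℝ => f (q + t • (x - q))) := by
    refine ⟨convex_univ, fun s _ t _ a b ha hb hab => ?_⟩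
    have h1 := hc.2 (Set.mem_univ (q + s • (x - q))) (Set.mem_univ (q + t • (x - q))) ha hb hab
    have h2 : a • (q + s • (x - q)) + b • (q + t • (x - q)) =
        q + (a • s + b • t) • (x - q) := by
      obtain rfl : b = 1 - a := by linarith
      simp only [smul_eq_mul]
      module
    rw [h2] at h1
    exact h1
  have hd := line_deriv hf q (x - q) 0
  have := hconv.le_slope_of_hasDerivAt (Set.mem_univ 0) (Set.mem_univ 1) one_pos hd
  simp only [slope_def_field, fderiv_eq_inner, zero_smul, add_zero, one_smul, add_sub_cancel,
    sub_zero, div_one] at this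
  linarith

lemma hess_nonneg {f : E2 → ℝ} (hf : ContDiff ℝ (⊤ : ℕ∞) f) (hc : ConvexOn ℝ Set.univ f)
    (q v : E2) : 0 ≤ hess f q v v := by
  refine (cmp_oneD (fun t => f q + t * ⟪gradient f q, v⟫) (fun t => f (q + t • v))
    (fun _ => ⟪gradient f q, v⟫) _ 0 _ ?_ (line_deriv hf q v) (hasDerivAt_const _ _)
    (line_deriv2 hf q v) ?_).2
  · intro t
    simpa using ((hasDerivAt_id t).mul_const ⟪gradient f q, v⟫).const_add (f q)
  · intro t
    have := tangent_le hf hc q (q + t • v)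
    simp only [add_sub_cancel_left, inner_smul_right, zero_mul, add_zero, zero_smul] at this ⊢
    linarith

def leg (g : E2 → ℝ) (z : E2) : ℝ := ⨆ p : E2, (⟪p, z⟫ - g p)

lemma leg_bdd {g : E2 → ℝ} {M : ℝ} (hM : ∀ p, ‖p‖ - M ≤ g p) {z : E2} (hz : ‖z‖ ≤ 1) :
    BddAbove (Set.range fun p : E2 => (⟪p, z⟫ - g p)) := by
  refine ⟨M, ?_⟩
  rintro _ ⟨p, rfl⟩
  have h1 := real_inner_le_norm p z
  have h2 := hM p
  have h3 : ‖p‖ * ‖z‖ ≤ ‖p‖ * 1 := by gcongr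
  simp only
  linarith

lemma le_leg {g : E2 → ℝ} {M : ℝ} (hM : ∀ p, ‖p‖ - M ≤ g p) {z : E2} (hz : ‖z‖ ≤ 1) (p : E2) :
    ⟪p, z⟫ - g p ≤ leg g z := le_ciSup (leg_bdd hM hz) p

lemma leg_convex {g : E2 → ℝ} {M : ℝ} (hM : ∀ p, ‖p‖ - M ≤ g p) :
    ConvexOn ℝ (ball (0 : E2) 1) (leg g) := by
  refine ⟨convex_ball _ _, ?_⟩
  intro x hx y hy a b ha hb hab
  have hx' : ‖x‖ ≤ 1 := (mem_ball_zero_iff.1 hx).le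
  have hy' : ‖y‖ ≤ 1 := (mem_ball_zero_iff.1 hy).le
  refine ciSup_le fun p => ?_
  have h1 := mul_le_mul_of_nonneg_left (le_leg hM hx' p) ha
  have h2 := mul_le_mul_of_nonneg_left (le_leg hM hy' p) hb
  simp only [inner_add_right, inner_smul_right, smul_eq_mul]
  have : g p = a * g p + b * g p := by rw [← add_mul, hab, one_mul]
  linarith

lemma leg_cont {g : E2 → ℝ} {M : ℝ} (hM : ∀ p, ‖p‖ - M ≤ g p) :
    ContinuousOn (leg g) (ball (0 : E2) 1) :=
  (leg_convex hM).continuousOn isOpen_ball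

lemma leg_attained {g : E2 → ℝ} {M : ℝ} (hM : ∀ p, ‖p‖ - M ≤ g p) (hg : Continuous g)
    {z : E2} (hz : ‖z‖ < 1) : ∃ q, leg g z = ⟪q, z⟫ - g q := by
  have hcont : Continuous fun p : E2 => g p - ⟪p, z⟫ := by fun_prop
  have htend : Tendsto (fun p : E2 => g p - ⟪p, z⟫) (cocompact E2) atTop := by
    have h1 : Tendsto (fun p : E2 => (1 - ‖z‖) * ‖p‖ + (-M)) (cocompact E2) atTop :=
      tendsto_atTop_add_const_right _ _
        ((tendsto_norm_cocompact_atTop (E := E2)).const_mul_atTop (by linarith))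
    refine tendsto_atTop_mono (fun p => ?_) h1
    have h1 := real_inner_le_norm p z
    have h2 := hM p
    nlinarith
  obtain ⟨q, hq⟩ := hcont.exists_forall_le htend
  refine ⟨q, le_antisymm (ciSup_le fun p => ?_) (le_leg hM hz.le q)⟩
  have := hq p
  linarith

lemma attain {f g : E2 → ℝ} (hf : ContDiff ℝ (⊤ : ℕ∞) f) (hc : ConvexOn ℝ Set.univ f)
    (hsp : ∀ p : E2, ‖gradient f p‖ < 1) {M N : ℝ} (hM : ∀ p, ‖p‖ - M ≤ f p)
    (hg : Continuous g) (hN : ∀ p, ‖p‖ - N ≤ g p)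
    (hb : ∀ ζ : E2, ‖ζ‖ = 1 → ∀ ε > 0, ∀ᶠ z in 𝓝 ζ, ‖z‖ < 1 → ∀ q : E2, ∃ p : E2,
      ⟪q, z⟫ - g q ≤ ⟪p, z⟫ - f p + ε) :
    (∀ y, f y ≤ g y) ∨ ∃ q, ∀ x, f x - g x ≤ f q - g q := by
  -- `f` is recovered from its Legendre transform on the open disc
  have hrec : ∀ x, f x = ⟪x, gradient f x⟫ - leg f (gradient f x) := by
    intro x
    have h1 := le_leg hM (hsp x).le x
    have h2 : leg f (gradient f x) ≤ ⟪x, gradient f x⟫ - f x := by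
      refine ciSup_le fun p => ?_
      have := tangent_le hf hc x p
      rw [inner_sub_right, real_inner_comm, real_inner_comm x] at this
      linarith
    linarith
  have hbound : ∀ m : ℝ, (∀ z : E2, ‖z‖ < 1 → leg g z - leg f z ≤ m) → ∀ x, f x ≤ g x + m := by
    intro m hm x
    have h1 := hm _ (hsp x)
    have h2 := le_leg hN (hsp x).le x
    have h3 := hrec x
    linarith
  let D : E2 → ℝ := fun z => if ‖z‖ < 1 then max (leg g z - leg f z) 0 else 0
  have hD0 : ∀ z, 0 ≤ D z := by
    intro z
    simp only [D]
    split_ifs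
    · exact le_max_right _ _
    · exact le_rfl
  have hDc : ContinuousOn D (closedBall (0 : E2) 1) := by
    intro z hz
    rw [mem_closedBall_zero_iff] at hz
    rcases hz.lt_or_eq with hz | hz
    · apply ContinuousAt.continuousWithinAt
      have hmem : ball (0 : E2) 1 ∈ 𝓝 z := isOpen_ball.mem_nhds (mem_ball_zero_iff.2 hz)
      have h1 : ContinuousAt (fun z => max (leg g z - leg f z) 0) z :=
        (((leg_cont hN).continuousAt hmem).sub ((leg_cont hM).continuousAt hmem)).max
          continuousAt_const
      refine h1.congr ?_
      filter_upwards [hmem] with w hw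
      have : ‖w‖ < 1 := mem_ball_zero_iff.1 hw
      simp [D, this]
    · apply ContinuousAt.continuousWithinAt
      have hDz : D z = 0 := by simp [D, hz]
      rw [ContinuousAt, hDz, Metric.tendsto_nhds]
      intro ε hε
      filter_upwards [hb z hz (ε / 2) (by linarith)] with w hw
      rw [Real.dist_eq, sub_zero, abs_of_nonneg (hD0 w)]
      simp only [D]
      split_ifs with hw1
      · apply max_lt _ hε
        have : leg g w ≤ leg f w + ε / 2 := by
          refine ciSup_le fun q => ?_
          obtain ⟨p, hp⟩ := hw hw1 q
          have := le_leg hM hw1.le p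
          linarith
        linarith
      · exact hε
  obtain ⟨z, hz, hzmax⟩ := (isCompact_closedBall (0 : E2) 1).exists_isMaxOn
    ⟨0, by simp⟩ hDc
  have hle : ∀ w : E2, ‖w‖ < 1 → leg g w - leg f w ≤ D z := by
    intro w hw
    have h1 : D w ≤ D z := hzmax (mem_closedBall_zero_iff.2 hw.le)
    have h2 : leg g w - leg f w ≤ D w := by simp [D, hw]
    linarith
  rcases (hD0 z).eq_or_lt with h0 | h0
  · left
    intro y
    have := hbound _ hle y
    linarith
  · right
    have hz1 : ‖z‖ < 1 := by
      by_contra h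
      simp [D, h] at h0
    have hDz : D z = leg g z - leg f z := by
      have : D z = max (leg g z - leg f z) 0 := by simp [D, hz1]
      rw [this] at h0 ⊢
      exact max_eq_left (by_contra fun h => by
        rw [max_eq_right (by linarith)] at h0
        exact lt_irrefl _ h0)
    obtain ⟨q, hq⟩ := leg_attained hN hg hz1
    refine ⟨q, fun x => ?_⟩
    have h1 := hbound _ hle x
    have h2 := le_leg hM hz1.le q
    linarith

lemma e2_decomp (v : E2) :
    v = v 0 • EuclideanSpace.single (0 : Fin 2) (1 : ℝ) +
      v 1 • EuclideanSpace.single (1 : Fin 2) (1 : ℝ) := by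
  ext i; fin_cases i <;> simp

lemma det_cmp {f g : E2 → ℝ} (hf : ContDiff ℝ (⊤ : ℕ∞) f) (hc : ConvexOn ℝ Set.univ f)
    {q : E2} (hmax : ∀ x, f x - g x ≤ f q - g q) (G1 : E2 → ℝ → ℝ) (α β γ : ℝ)
    (hG : ∀ v t, HasDerivAt (fun t : ℝ => g (q + t • v)) (G1 v t) t)
    (hG1 : ∀ v : E2, HasDerivAt (G1 v) (α * v 0 ^ 2 + 2 * β * v 0 * v 1 + γ * v 1 ^ 2) 0) :
    (∀ v, ⟪gradient f q, v⟫ = G1 v 0) ∧ detHess f q ≤ α * γ - β * β := by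
  have key : ∀ v : E2, fderiv ℝ f (q + (0 : ℝ) • v) v = G1 v 0 ∧
      hess f q v v ≤ α * v 0 ^ 2 + 2 * β * v 0 * v 1 + γ * v 1 ^ 2 := by
    intro v
    refine cmp_oneD _ _ _ _ _ _ (line_deriv hf q v) (hG v) (line_deriv2 hf q v) (hG1 v) ?_
    intro t
    simpa using hmax (q + t • v)
  constructor
  · intro v
    have := (key v).1
    rwa [zero_smul, add_zero, fderiv_eq_inner] at this
  · unfold detHess
    rw [hess_symm hf q (EuclideanSpace.single 1 1) (EuclideanSpace.single 0 1)]
    apply det_mono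
    · intro x y
      rw [← hess_quad hf]
      exact hess_nonneg hf hc _ _
    · intro x y
      rw [← hess_quad hf]
      refine (key _).2.trans (le_of_eq ?_)
      simp

lemma no_max {f₁ f₂ : E2 → ℝ} {k₁ k₂ : ℝ} (hk : k₂ < k₁)
    (hf₁s : ContDiff ℝ (⊤ : ℕ∞) f₁) (hf₁c : ConvexOn ℝ Set.univ f₁)
    (hf₁sp : ∀ p : E2, ‖gradient f₁ p‖ < 1)
    (hf₁eq : ∀ p : E2, detHess f₁ p = k₁ * (1 - ‖gradient f₁ p‖ ^ 2) ^ 2)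
    (hf₂s : ContDiff ℝ (⊤ : ℕ∞) f₂)
    (hf₂eq : ∀ p : E2, detHess f₂ p = k₂ * (1 - ‖gradient f₂ p‖ ^ 2) ^ 2)
    {q : E2} (hmax : ∀ x, f₁ x - f₂ x ≤ f₁ q - f₂ q) : False := by
  obtain ⟨h1, h2⟩ := det_cmp hf₁s hf₁c hmax (fun v t => fderiv ℝ f₂ (q + t • v) v)
    (hess f₂ q (EuclideanSpace.single 0 1) (EuclideanSpace.single 0 1))
    (hess f₂ q (EuclideanSpace.single 0 1) (EuclideanSpace.single 1 1))
    (hess f₂ q (EuclideanSpace.single 1 1) (EuclideanSpace.single 1 1))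
    (line_deriv hf₂s q) (fun v => by
      rw [← hess_quad hf₂s, ← e2_decomp]
      exact line_deriv2 hf₂s q v)
  have hgrad : gradient f₁ q = gradient f₂ q := by
    apply ext_inner_right ℝ
    intro v
    rw [h1 v, zero_smul, add_zero, fderiv_eq_inner]
  have h3 : detHess f₁ q ≤ detHess f₂ q := by
    refine h2.trans (le_of_eq ?_)
    unfold detHess
    rw [hess_symm hf₂s q (EuclideanSpace.single 1 1) (EuclideanSpace.single 0 1)]
  rw [hf₁eq, hf₂eq, ← hgrad] at h3
  have h4 : ‖gradient f₁ q‖ ^ 2 < 1 := by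
    have := hf₁sp q
    have := norm_nonneg (gradient f₁ q)
    nlinarith
  have h5 : 0 < (1 - ‖gradient f₁ q‖ ^ 2) ^ 2 := by
    have : 0 < 1 - ‖gradient f₁ q‖ ^ 2 := by linarith
    positivity
  have := lt_of_mul_lt_mul_right (lt_of_le_of_ne h3 ?_) h5.le
  · linarith
  · intro h
    have := mul_right_cancel₀ h5.ne' h
    linarith

lemma no_max_hyp {f : E2 → ℝ} {k c C : ℝ} (hc0 : 0 < c) (hk : 1 < k * c ^ 2)
    (hfs : ContDiff ℝ (⊤ : ℕ∞) f) (hfc : ConvexOn ℝ Set.univ f)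
    (hfeq : ∀ p : E2, detHess f p = k * (1 - ‖gradient f p‖ ^ 2) ^ 2)
    (q₀ q : E2)
    (hmax : ∀ x, f x - (C + √(c ^ 2 + ‖x - q₀‖ ^ 2)) ≤ f q - (C + √(c ^ 2 + ‖q - q₀‖ ^ 2))) :
    False := by
  set w : E2 := q - q₀ with hw
  set s : ℝ := √(c ^ 2 + ‖w‖ ^ 2) with hs
  have hpos : 0 < c ^ 2 + ‖w‖ ^ 2 := by positivity
  have hs0 : 0 < s := Real.sqrt_pos.2 hpos
  have hs2 : s ^ 2 = c ^ 2 + ‖w‖ ^ 2 := Real.sq_sqrt hpos.le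
  have hP : ∀ (v : E2) (t : ℝ), HasDerivAt (fun t : ℝ => c ^ 2 + ‖q + t • v - q₀‖ ^ 2)
      (2 * (⟪w, v⟫ + t * ‖v‖ ^ 2)) t := by
    intro v t
    have he : (fun t : ℝ => c ^ 2 + ‖q + t • v - q₀‖ ^ 2) =
        fun t : ℝ => (c ^ 2 + ‖w‖ ^ 2) + (t * (2 * ⟪w, v⟫) + t ^ 2 * ‖v‖ ^ 2) := by
      funext t
      have : q + t • v - q₀ = w + t • v := by rw [hw]; abel
      rw [this, norm_add_sq_real, inner_smul_right, norm_smul, mul_pow, Real.norm_eq_abs, sq_abs]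
      ring
    rw [he]
    have h1 := ((hasDerivAt_id t).mul_const (2 * ⟪w, v⟫)).add
      (((hasDerivAt_id t).pow 2).mul_const (‖v‖ ^ 2))
    refine (h1.const_add (c ^ 2 + ‖w‖ ^ 2)).congr_deriv ?_
    simp; ring
  have hPpos : ∀ (v : E2) (t : ℝ), 0 < c ^ 2 + ‖q + t • v - q₀‖ ^ 2 := by
    intro v t; positivity
  obtain ⟨h1, h2⟩ := det_cmp (g := fun x => C + √(c ^ 2 + ‖x - q₀‖ ^ 2)) hfs hfc hmax
    (fun v t => (⟪w, v⟫ + t * ‖v‖ ^ 2) / √(c ^ 2 + ‖q + t • v - q₀‖ ^ 2))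
    (1 / s - w 0 ^ 2 / s ^ 3) (- (w 0 * w 1) / s ^ 3) (1 / s - w 1 ^ 2 / s ^ 3)
    (fun v t => by
      have := ((hP v t).sqrt (hPpos v t).ne').const_add C
      refine this.congr_deriv ?_
      have := (Real.sqrt_pos.2 (hPpos v t)).ne'
      field_simp)
    (fun v => by
      have hd := (hP v 0).sqrt (hPpos v 0).ne'
      have hn : HasDerivAt (fun t : ℝ => ⟪w, v⟫ + t * ‖v‖ ^ 2) (‖v‖ ^ 2) 0 := by
        simpa using ((hasDerivAt_id (0 : ℝ)).mul_const (‖v‖ ^ 2)).const_add ⟪w, v⟫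
      have := hn.div hd (Real.sqrt_pos.2 (hPpos v 0)).ne'
      refine this.congr_deriv ?_
      simp only [zero_smul, add_zero, zero_mul]
      rw [← hw, ← hs]
      have hv : ‖v‖ ^ 2 = v 0 ^ 2 + v 1 ^ 2 := by
        simp [EuclideanSpace.norm_sq_eq, Fin.sum_univ_two]
      have hi : ⟪w, v⟫ = w 0 * v 0 + w 1 * v 1 := by
        simp [PiLp.inner_apply, Fin.sum_univ_two]; ring
      rw [hv, hi]
      field_simp
      ring)
  have hgrad : gradient f q = s⁻¹ • w := by
    apply ext_inner_right ℝ
    intro v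
    rw [h1 v, real_inner_smul_left]
    simp only [zero_smul, add_zero, zero_mul]
    rw [← hw, ← hs]
    field_simp
  rw [hfeq, hgrad, norm_smul, norm_inv, Real.norm_of_nonneg hs0.le, mul_pow] at h2
  have hwn : ‖w‖ ^ 2 = w 0 ^ 2 + w 1 ^ 2 := by
    simp [EuclideanSpace.norm_sq_eq, Fin.sum_univ_two]
  have hL : k * (1 - s⁻¹ ^ 2 * ‖w‖ ^ 2) ^ 2 = k * c ^ 4 / s ^ 4 := by
    have : 1 - s⁻¹ ^ 2 * ‖w‖ ^ 2 = c ^ 2 / s ^ 2 := by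
      field_simp; linarith
    rw [this]; field_simp
  have hR : (1 / s - w 0 ^ 2 / s ^ 3) * (1 / s - w 1 ^ 2 / s ^ 3) -
      (- (w 0 * w 1) / s ^ 3) * (- (w 0 * w 1) / s ^ 3) = c ^ 2 / s ^ 4 := by
    have hc2 : c ^ 2 = s ^ 2 - w 0 ^ 2 - w 1 ^ 2 := by linarith
    rw [hc2]
    field_simp
    ring
  rw [hL, hR, div_le_div_iff_of_pos_right (by positivity)] at h2
  have : 0 < c ^ 2 := by positivity
  nlinarith

lemma support_le {f : E2 → ℝ} (hf : ContDiff ℝ (⊤ : ℕ∞) f) (hc : ConvexOn ℝ Set.univ f)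
    (hsp : ∀ p : E2, ‖gradient f p‖ < 1) {ζ : E2} (hζ : ‖ζ‖ = 1) {l : ℝ}
    (hl : Tendsto (fun r : ℝ => r - f (r • ζ)) atTop (𝓝 l)) (q : E2) : ⟪q, ζ⟫ - f q ≤ l := by
  have h0 : Tendsto (fun r : ℝ => r - f (r • ζ) + ‖q‖ ^ 2 / r) atTop (𝓝 (l + 0)) :=
    hl.add (tendsto_const_nhds.div_atTop tendsto_id)
  rw [add_zero] at h0
  refine ge_of_tendsto h0 ?_
  filter_upwards [eventually_ge_atTop (2 * |⟪q, ζ⟫|), eventually_gt_atTop 0] with r hr hr0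
  have h1 := tangent_le hf hc (r • ζ) q
  have h2 := neg_le_of_abs_le (abs_real_inner_le_norm (gradient f (r • ζ)) (q - r • ζ))
  have h3 : ‖gradient f (r • ζ)‖ * ‖q - r • ζ‖ ≤ 1 * ‖q - r • ζ‖ := by
    gcongr; exact (hsp _).le
  have hb := abs_le.1 (show |⟪q, ζ⟫| ≤ r / 2 by linarith)
  have he : 0 ≤ ‖q‖ ^ 2 / r := by positivity
  have her : ‖q‖ ^ 2 / r * r = ‖q‖ ^ 2 := by field_simp
  have h4 : ‖q - r • ζ‖ ≤ r - ⟪q, ζ⟫ + ‖q‖ ^ 2 / r := by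
    refine abs_le_of_sq_le_sq' ?_ (by linarith [hb.2]) |>.2
    rw [norm_sub_sq_real, inner_smul_right, norm_smul, hζ, mul_one, Real.norm_eq_abs, sq_abs]
    nlinarith [hb.2, sq_nonneg (⟪q, ζ⟫), mul_nonneg he (show 0 ≤ r / 2 - ⟪q, ζ⟫ by linarith [hb.2])]
  linarith

lemma coercive {f φ : E2 → ℝ} {M : ℝ} (hM : ∀ z ∈ sphere (0 : E2) 1, |φ z| ≤ M)
    (h : ∀ ζ : E2, ‖ζ‖ = 1 → ∀ q, ⟪q, ζ⟫ - f q ≤ φ ζ) (p : E2) : ‖p‖ - M ≤ f p := by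
  have hex : ∃ ζ : E2, ‖ζ‖ = 1 ∧ ⟪p, ζ⟫ = ‖p‖ := by
    by_cases hp : p = 0
    · exact ⟨EuclideanSpace.single 0 1, by simp, by simp [hp]⟩
    · have hp' : ‖p‖ ≠ 0 := norm_ne_zero_iff.2 hp
      refine ⟨‖p‖⁻¹ • p, by rw [norm_smul, norm_inv, norm_norm, inv_mul_cancel₀ hp'], ?_⟩
      rw [inner_smul_right, real_inner_self_eq_norm_sq]
      field_simp
  obtain ⟨ζ, h1, h2⟩ := hex
  have h3 := h ζ h1 p
  have h4 := (abs_le.1 (hM ζ (by simpa using h1))).2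
  linarith

/-- **Step 1 of Theorem 4.1.** Two constant curvature spacelike entire graphs with the same
bounded lower semicontinuous support function at infinity `φ` and curvatures `K₁ < K₂ < 0`
are disjoint: the `K₂`-surface is strictly in the future of the `K₁`-surface. -/
theorem constant_curvature_surfaces_ordered
    (φ : E2 → ℝ)
    (hφb : ∃ M : ℝ, ∀ z ∈ sphere (0 : E2) 1, |φ z| ≤ M)
    (hφl : LowerSemicontinuousOn φ (sphere (0 : E2) 1))
    (K₁ K₂ : ℝ) (h₁₂ : K₁ < K₂) (h₂ : K₂ < 0)
    (f₁ f₂ : E2 → ℝ)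
    (hf₁s : ContDiff ℝ (⊤ : ℕ∞) f₁) (hf₁c : ConvexOn ℝ Set.univ f₁)
    (hf₁sp : ∀ p : E2, ‖gradient f₁ p‖ < 1)
    (hf₁eq : ∀ p : E2, detHess f₁ p = |K₁| * (1 - ‖gradient f₁ p‖ ^ 2) ^ 2)
    (hf₁bd : ∀ z ∈ sphere (0 : E2) 1,
      Tendsto (fun r : ℝ => r - f₁ (r • z)) atTop (𝓝 (φ z)))
    (hf₂s : ContDiff ℝ (⊤ : ℕ∞) f₂) (hf₂c : ConvexOn ℝ Set.univ f₂)
    (hf₂sp : ∀ p : E2, ‖gradient f₂ p‖ < 1)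
    (hf₂eq : ∀ p : E2, detHess f₂ p = |K₂| * (1 - ‖gradient f₂ p‖ ^ 2) ^ 2)
    (hf₂bd : ∀ z ∈ sphere (0 : E2) 1,
      Tendsto (fun r : ℝ => r - f₂ (r • z)) atTop (𝓝 (φ z))) :
    ∀ y : E2, f₁ y < f₂ y := by
  obtain ⟨M, hM⟩ := hφb
  have hs₁ : ∀ ζ : E2, ‖ζ‖ = 1 → ∀ q, ⟪q, ζ⟫ - f₁ q ≤ φ ζ := fun ζ hζ q =>
    support_le hf₁s hf₁c hf₁sp hζ (hf₁bd ζ (by simpa using hζ)) q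
  have hs₂ : ∀ ζ : E2, ‖ζ‖ = 1 → ∀ q, ⟪q, ζ⟫ - f₂ q ≤ φ ζ := fun ζ hζ q =>
    support_le hf₂s hf₂c hf₂sp hζ (hf₂bd ζ (by simpa using hζ)) q
  have hM₁ := coercive hM hs₁
  have hM₂ := coercive hM hs₂
  have hk : |K₂| < |K₁| := by
    rw [abs_of_neg h₂, abs_of_neg (h₁₂.trans h₂)]; linarith
  have hk2 : 0 < |K₂| := abs_pos.2 h₂.ne
  obtain ⟨c, hc0, hc⟩ : ∃ c : ℝ, 0 < c ∧ 1 < |K₁| * c ^ 2 := by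
    refine ⟨√(1 / |K₂|), Real.sqrt_pos.2 (by positivity), ?_⟩
    rw [Real.sq_sqrt (by positivity), mul_one_div, lt_div_iff₀ hk2]
    linarith
  -- Barrier: `f₁` lies below every hyperboloid based at a point of the graph of `f₂`.
  have hbar : ∀ q p : E2, f₁ p ≤ f₂ q + √(c ^ 2 + ‖p - q‖ ^ 2) := by
    intro q
    have hge : ∀ p : E2, ‖p - q‖ ≤ √(c ^ 2 + ‖p - q‖ ^ 2) := fun p =>
      Real.le_sqrt_of_sq_le (by nlinarith [sq_nonneg c])
    have := attain (g := fun p => f₂ q + √(c ^ 2 + ‖p - q‖ ^ 2)) hf₁s hf₁c hf₁sp hM₁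
      (by fun_prop) (N := ‖q‖ - f₂ q) (fun p => by
        have h1 := hge p
        have h2 := norm_sub_norm_le p q
        linarith) ?_
    · rcases this with h | ⟨x, hx⟩
      · exact h
      · exact (no_max_hyp hc0 hc hf₁s hf₁c hf₁eq q x hx).elim
    · intro ζ hζ ε hε
      have h1 := hs₂ ζ hζ q
      obtain ⟨r, hr⟩ := ((hf₁bd ζ (by simpa using hζ)).eventually_const_lt
        (show φ ζ - ε < φ ζ by linarith)).exists
      have hcont : Continuous fun z : E2 => ⟪r • ζ, z⟫ - f₁ (r • ζ) + ε - (⟪q, z⟫ - f₂ q) := by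
        fun_prop
      have hpos : 0 < ⟪r • ζ, ζ⟫ - f₁ (r • ζ) + ε - (⟪q, ζ⟫ - f₂ q) := by
        rw [real_inner_smul_left, real_inner_self_eq_norm_sq, hζ]
        linarith
      filter_upwards [hcont.continuousAt.eventually_const_lt hpos] with z hz hz1 x
      refine ⟨r • ζ, ?_⟩
      have h2 := hge x
      have h3 := real_inner_le_norm (x - q) z
      have h4 : ‖x - q‖ * ‖z‖ ≤ ‖x - q‖ * 1 := by gcongr
      rw [inner_sub_left] at h3
      linarith
  have hmain := attain (g := f₂) hf₁s hf₁c hf₁sp hM₁ hf₂s.continuous hM₂ ?_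
  · have hno : ∀ q, ¬ ∀ x, f₁ x - f₂ x ≤ f₁ q - f₂ q := fun q hq =>
      no_max hk hf₁s hf₁c hf₁sp hf₁eq hf₂s hf₂eq hq
    rcases hmain with h | ⟨q, hq⟩
    · intro y
      refine lt_of_le_of_ne (h y) fun hy => hno y fun x => ?_
      have := h x
      linarith
    · exact (hno q hq).elim
  · intro ζ hζ ε hε
    have hcont : Continuous fun z : E2 => c * √(1 - ‖z‖ ^ 2) := by fun_prop
    have hlt : c * √(1 - ‖ζ‖ ^ 2) < ε := by simp [hζ, hε]
    filter_upwards [hcont.continuousAt.eventually_lt_const hlt] with z hz hz1 q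
    have hpos : 0 < 1 - ‖z‖ ^ 2 := by nlinarith [norm_nonneg z]
    set s := √(1 - ‖z‖ ^ 2) with hs
    have hs0 : 0 < s := Real.sqrt_pos.2 hpos
    have hs2 : s ^ 2 = 1 - ‖z‖ ^ 2 := Real.sq_sqrt hpos.le
    refine ⟨q + (c / s) • z, ?_⟩
    have h1 := hbar q (q + (c / s) • z)
    have h2 : √(c ^ 2 + ‖q + (c / s) • z - q‖ ^ 2) = c / s := by
      rw [add_sub_cancel_left, norm_smul, Real.norm_of_nonneg (by positivity),
        Real.sqrt_eq_iff_mul_self_eq (by positivity) (by positivity)]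
      field_simp
      linarith
    rw [h2] at h1
    rw [inner_add_left, real_inner_smul_left, real_inner_self_eq_norm_sq]
    have h3 : c / s * ‖z‖ ^ 2 = c / s - c * s := by
      have : ‖z‖ ^ 2 = 1 - s ^ 2 := by linarith
      rw [this]; field_simp
    linarith
end
end

section
/- Let ψ : 𝔻 → ℝ be a smooth function with 0 < ψ(z) ≤ b for all z ∈ 𝔻 and some b < +∞, and let u : 𝔻 → ℝ be a smooth convex bounded function satisfying det D²u(z) = (1/ψ(z))·(1−|z|²)⁻² for every z ∈ 𝔻. Then ∇u(𝔻) = ℝ²; equivalently, the convex surface in Minkowski space dual to u (parametrized by z ↦ (∇u(z), ⟨z, ∇u(z)⟩ − u(z))) is a spacelike entire graph, with curvature −ψ(z) at the point whose Gauss-map image is z. -/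
open Metric Filter
open scoped RealInnerProductSpace Topology

noncomputable section

lemma D2 (f f' : ℝ → ℝ) (c : ℝ) (h1 : ∀ᶠ s in 𝓝 0, HasDerivAt f (f' s) s)
    (h2 : HasDerivAt f' c 0) (hmax : IsLocalMax f 0) : c ≤ 0 := by
  by_contra hc
  push Not at hc
  have e1 : deriv f =ᶠ[𝓝 0] f' := h1.mono fun s hs => hs.deriv
  have d2 : deriv (deriv f) 0 = c := by rw [e1.deriv_eq, h2.deriv]
  have hmin := isLocalMin_of_deriv_deriv_pos (f := f) (x₀ := 0) (by rw [d2]; exact hc)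
    hmax.deriv_eq_zero h1.self_of_nhds.continuousAt
  have e2 : f =ᶠ[𝓝 0] fun _ => f 0 := by
    filter_upwards [hmin, hmax] with s a b using le_antisymm b a
  have := e2.deriv.deriv_eq
  rw [d2] at this
  simp at this
  linarith

lemma det_id (u : E2 → ℝ) (p w v : E2) :
    hess u p w w * hess u p v v - hess u p w v * hess u p v w
      = (w 0 * v 1 - w 1 * v 0) ^ 2 * detHess u p := by
  have key : ∀ q : E2, q = q 0 • EuclideanSpace.single 0 1 + q 1 • EuclideanSpace.single 1 1 := by
    intro q; ext i; fin_cases i <;> simp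
  unfold detHess hess
  generalize fderiv ℝ (fderiv ℝ u) p = B
  conv_lhs => rw [key w, key v]
  simp only [map_add, map_smul, add_apply, smul_apply, smul_eq_mul]
  ring

lemma line_deriv_s19 (u : E2 → ℝ) (hus : ContDiffOn ℝ (⊤ : ℕ∞) u (ball (0 : E2) 1)) (p v : E2)
    (hp : p ∈ ball (0 : E2) 1) :
    (∀ᶠ s : ℝ in 𝓝 0, HasDerivAt (fun s : ℝ => u (p + s • v)) (fderiv ℝ u (p + s • v) v) s) ∧
    HasDerivAt (fun s : ℝ => fderiv ℝ u (p + s • v) v) (hess u p v v) 0 := by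
  have hl : ∀ s : ℝ, HasDerivAt (fun s : ℝ => p + s • v) v s := fun s => by
    simpa using ((hasDerivAt_id s).smul_const v).const_add p
  constructor
  · have hc : ∀ᶠ s : ℝ in 𝓝 0, p + s • v ∈ ball (0 : E2) 1 := by
      apply (hl 0).continuousAt
      simpa using isOpen_ball.mem_nhds hp
    filter_upwards [hc] with s hs
    have : DifferentiableAt ℝ u (p + s • v) :=
      (hus.contDiffAt (isOpen_ball.mem_nhds hs)).differentiableAt (by simp)
    exact this.hasFDerivAt.comp_hasDerivAt s (hl s)
  · have h1 : ContDiffAt ℝ 1 (fderiv ℝ u) p :=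
      (hus.contDiffAt (isOpen_ball.mem_nhds hp)).fderiv_right (by norm_cast)
    have h2 := (h1.differentiableAt (by simp)).hasFDerivAt
    have h3 : HasDerivAt (fun s : ℝ => fderiv ℝ u (p + s • v)) (fderiv ℝ (fderiv ℝ u) p v) 0 := by
      have h2' : HasFDerivAt (fderiv ℝ u) (fderiv ℝ (fderiv ℝ u) p) (p + (0:ℝ) • v) := by simpa using h2
      exact h2'.comp_hasDerivAt 0 (hl 0)
    simpa [hess] using h3.clm_apply (hasDerivAt_const (0:ℝ) v)

lemma hess_nonneg_s19 (u : E2 → ℝ) (hus : ContDiffOn ℝ (⊤ : ℕ∞) u (ball (0 : E2) 1))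
    (huc : ConvexOn ℝ (ball (0 : E2) 1) u) (p v : E2)
    (hp : p ∈ ball (0 : E2) 1) : 0 ≤ hess u p v v := by
  obtain ⟨h1, h2⟩ := line_deriv_s19 u hus p v hp
  set d := fderiv ℝ u p v with hd
  have hl : ∀ s : ℝ, HasDerivAt (fun s : ℝ => s * d) d s := fun s => by
    simpa using (hasDerivAt_id s).mul_const d
  have := D2 (fun s => s * d - u (p + s • v)) (fun s => d - fderiv ℝ u (p + s • v) v)
    (0 - hess u p v v) (h1.mono fun s hs => (hl s).sub hs) ((hasDerivAt_const _ _).sub h2) ?_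
  · linarith
  let L : ℝ →ᵃ[ℝ] E2 := AffineMap.lineMap p (p + v)
  have hL : ∀ s, L s = p + s • v := fun s => by simp [L, AffineMap.lineMap_apply, add_comm]
  have hcv := huc.comp_affineMap L
  have hmem : (0:ℝ) ∈ L ⁻¹' ball (0 : E2) 1 := by simpa [hL] using hp
  have hopen : L ⁻¹' ball (0 : E2) 1 ∈ 𝓝 (0:ℝ) := by
    refine (isOpen_ball.preimage ?_).mem_nhds hmem
    have : (L : ℝ → E2) = fun s => p + s • v := funext hL
    rw [this]; fun_prop
  have hcomp : u ∘ L = fun s : ℝ => u (p + s • v) := by funext s; simp [hL]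
  rw [hcomp] at hcv
  have hd0 : HasDerivAt (fun s : ℝ => u (p + s • v)) d 0 := by simpa using h1.self_of_nhds
  filter_upwards [hopen] with s hs
  simp only [zero_mul, zero_smul, add_zero]
  rcases lt_trichotomy s 0 with h | h | h
  · have := hcv.slope_le_of_hasDerivAt hs hmem h hd0
    simp [slope_def_field] at this
    rw [div_le_iff₀ (by linarith)] at this
    linarith
  · simp [h]
  · have := hcv.le_slope_of_hasDerivAt hmem hs h hd0
    simp [slope_def_field] at this
    rw [le_div_iff₀ h] at this
    linarith

lemma second_order (u : E2 → ℝ) (hus : ContDiffOn ℝ (⊤ : ℕ∞) u (ball (0 : E2) 1)) (w p v : E2)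
    (hp : p ∈ ball (0 : E2) 1) (V V' : ℝ → ℝ) (c : ℝ)
    (hV : ∀ᶠ s in 𝓝 0, HasDerivAt V (V' s) s) (hV' : HasDerivAt V' c 0)
    (hmax : IsLocalMax (fun s : ℝ => u (p + s • v) - ⟪w, p + s • v⟫ - V s) 0) :
    hess u p v v ≤ c := by
  obtain ⟨h1, h2⟩ := line_deriv_s19 u hus p v hp
  have hl : ∀ s : ℝ, HasDerivAt (fun s : ℝ => ⟪w, p + s • v⟫) ⟪w, v⟫ s := fun s => by
    simp only [inner_add_right, inner_smul_right]
    simpa using ((hasDerivAt_id s).mul_const (⟪w, v⟫)).const_add (⟪w, p⟫)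
  have := D2 _ (fun s => fderiv ℝ u (p + s • v) v - ⟪w, v⟫ - V' s) (hess u p v v - c)
    (by filter_upwards [h1, hV] with s a b using (a.sub (hl s)).sub b)
    ((h2.sub_const _).sub hV') hmax
  linarith

def tau (ζ : E2) : E2 := !₂[-ζ 1, ζ 0]

def PP (ζ : E2) (x t : ℝ) : E2 := (1 - x) • ζ + (x * t) • tau ζ

lemma PP_norm (ζ : E2) (hζ : ‖ζ‖ = 1) (x t : ℝ) : ‖PP ζ x t‖ ^ 2 = (1 - x) ^ 2 + (x * t) ^ 2 := by
  have h : ζ 0 ^ 2 + ζ 1 ^ 2 = 1 := by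
    have := EuclideanSpace.real_norm_sq_eq ζ
    rw [hζ, Fin.sum_univ_two] at this
    linarith
  rw [EuclideanSpace.real_norm_sq_eq, Fin.sum_univ_two]
  simp [PP, tau]
  linear_combination ((1 - x) ^ 2 + (x * t) ^ 2) * h

lemma PP_mem (ζ : E2) (hζ : ‖ζ‖ = 1) (x t : ℝ) (hx : 0 < x) (hx' : x ≤ 1 / 2)
    (ht : -1 ≤ t) (ht' : t ≤ 1) : PP ζ x t ∈ ball (0 : E2) 1 := by
  rw [mem_ball_zero_iff]
  have h := PP_norm ζ hζ x t
  have ht2 : t ^ 2 ≤ 1 := by nlinarith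
  have : x ^ 2 * t ^ 2 ≤ x ^ 2 * 1 := by gcongr
  have : ‖PP ζ x t‖ ^ 2 < 1 ^ 2 := by rw [h]; nlinarith
  exact lt_of_pow_lt_pow_left₀ 2 (by norm_num) this

lemma interior_est (ψ : E2 → ℝ) (b : ℝ)
    (hψ : ∀ z ∈ ball (0 : E2) 1, 0 < ψ z ∧ ψ z ≤ b)
    (u : E2 → ℝ)
    (hus : ContDiffOn ℝ (⊤ : ℕ∞) u (ball (0 : E2) 1))
    (huc : ConvexOn ℝ (ball (0 : E2) 1) u)
    (hueq : ∀ z ∈ ball (0 : E2) 1,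
      detHess u z = (1 / ψ z) * ((1 - ‖z‖ ^ 2) ^ 2)⁻¹)
    (ζ : E2) (hζ : ‖ζ‖ = 1) (x t : ℝ) (hx : 0 < x) (hx' : x ≤ 1 / 2)
    (ht : -1 ≤ t) (ht' : t ≤ 1) (c1 c2 : ℝ)
    (h1 : hess u (PP ζ x t) (-ζ + t • tau ζ) (-ζ + t • tau ζ) ≤ c1)
    (h2 : hess u (PP ζ x t) (x • tau ζ) (x • tau ζ) ≤ c2) : 1 / (4 * b) ≤ c1 * c2 := by
  have hp := PP_mem ζ hζ x t hx hx' ht ht'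
  have hd := det_id u (PP ζ x t) (-ζ + t • tau ζ) (x • tau ζ)
  have hsym : hess u (PP ζ x t) (-ζ + t • tau ζ) (x • tau ζ)
      = hess u (PP ζ x t) (x • tau ζ) (-ζ + t • tau ζ) := by
    have := (hus.contDiffAt (isOpen_ball.mem_nhds hp)).isSymmSndFDerivAt
      (by simp only [minSmoothness_of_isRCLikeNormedField]; norm_cast)
    exact this.eq _ _
  rw [hsym] at hd
  have hz : ζ 0 ^ 2 + ζ 1 ^ 2 = 1 := by
    have := EuclideanSpace.real_norm_sq_eq ζ
    rw [hζ, Fin.sum_univ_two] at this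
    linarith
  have hcoef : ((-ζ + t • tau ζ) 0 * (x • tau ζ) 1 - (-ζ + t • tau ζ) 1 * (x • tau ζ) 0) = -x := by
    simp [tau]
    linear_combination (-x) * hz
  rw [hcoef, hueq _ hp, PP_norm ζ hζ] at hd
  have n1 := hess_nonneg_s19 u hus huc (PP ζ x t) (-ζ + t • tau ζ) hp
  have n2 := hess_nonneg_s19 u hus huc (PP ζ x t) (x • tau ζ) hp
  have hm := mul_le_mul h1 h2 n2 (n1.trans h1)
  obtain ⟨q1, q2⟩ := hψ _ hp
  have hpos : 0 < 1 - ((1 - x) ^ 2 + (x * t) ^ 2) := by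
    have ht2 : t ^ 2 ≤ 1 := by nlinarith
    have : x ^ 2 * t ^ 2 ≤ x ^ 2 * 1 := by gcongr
    nlinarith
  have hle : 1 - ((1 - x) ^ 2 + (x * t) ^ 2) ≤ 2 * x := by nlinarith [sq_nonneg x, sq_nonneg (x*t)]
  have hfin : 1 / (4 * b) ≤ (-x) ^ 2 * (1 / ψ (PP ζ x t) *
      ((1 - ((1 - x) ^ 2 + (x * t) ^ 2)) ^ 2)⁻¹) := by
    calc 1 / (4 * b) = x ^ 2 * (1 / b * ((2 * x) ^ 2)⁻¹) := by
          have : b ≠ 0 := by linarith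
          field_simp; norm_num
      _ ≤ _ := by
          rw [neg_sq]; gcongr
  nlinarith [sq_nonneg (hess u (PP ζ x t) (x • tau ζ) (-ζ + t • tau ζ))]

lemma core (ψ : E2 → ℝ) (b : ℝ)
    (hψ : ∀ z ∈ ball (0 : E2) 1, 0 < ψ z ∧ ψ z ≤ b)
    (u : E2 → ℝ)
    (hus : ContDiffOn ℝ (⊤ : ℕ∞) u (ball (0 : E2) 1))
    (huc : ConvexOn ℝ (ball (0 : E2) 1) u)
    (hueq : ∀ z ∈ ball (0 : E2) 1,
      detHess u z = (1 / ψ z) * ((1 - ‖z‖ ^ 2) ^ 2)⁻¹)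
    (w ζ : E2) (hζ : ‖ζ‖ = 1) (m K : ℝ) (hK : 0 < K) (hKc : 1 / (4 * b) ≤ 16 * K ^ 2)
    (hm : ∀ z ∈ ball (0 : E2) 1, m ≤ u z - ⟪w, z⟫)
    (hup : ∀ x t : ℝ, 0 < x → x ≤ 1 / 2 → -1 ≤ t → t ≤ 1 →
      u (PP ζ x t) - ⟪w, PP ζ x t⟫ ≤ m + K * x) : False := by
  have hb : 0 < b := by
    obtain ⟨q1, q2⟩ := hψ 0 (by simp)
    linarith
  set c := 1 / (4 * b) with hc
  have hc0 : 0 < c := by positivity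
  set β := c / (16 * K) with hβ
  have hβ0 : 0 < β := by positivity
  have hβc : β * (16 * K) = c := by rw [hβ]; field_simp
  set N := 2 * K / β with hN
  have hNβ : N * β = 2 * K := by rw [hN]; field_simp
  have hβK : β ≤ K := by rw [hβ, div_le_iff₀ (by positivity)]; nlinarith
  have hN2 : 2 ≤ N := by rw [hN, le_div_iff₀ hβ0]; linarith
  set ε := Real.exp (-N) with hε
  have hε0 : 0 < ε := Real.exp_pos _
  have hε4 : 4 * ε < 1 := by
    have h1 : ε * Real.exp N = 1 := by rw [hε, ← Real.exp_add]; simp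
    have h2 : Real.exp 2 ≤ Real.exp N := Real.exp_le_exp.2 hN2
    have h3 : (4:ℝ) < Real.exp 2 := by
      have : Real.exp 2 = Real.exp 1 ^ 2 := by rw [← Real.exp_nat_mul]; norm_num
      rw [this]; nlinarith [Real.exp_one_gt_d9]
    nlinarith
  set δ := ε ^ 2 / 2 with hδ
  have hδ0 : 0 < δ := by positivity
  have hlogε : Real.log ε = -N := Real.log_exp _
  have hlogδ : Real.log (2 * δ) = -(2 * N) := by
    have : 2 * δ = ε ^ 2 := by rw [hδ]; ring
    rw [this, Real.log_pow, hlogε]; push_cast; ring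
  set h : ℝ → ℝ := fun x => K * x + β * (x * Real.log (2 * x)) + β * δ * (2 * N) with hh
  set Φ : ℝ × ℝ → ℝ := fun q => u (PP ζ q.1 q.2) - ⟪w, PP ζ q.1 q.2⟫
    - (m + 4 * K * q.2 ^ 2 * q.1 + h q.1) with hΦ
  set S : Set (ℝ × ℝ) := Set.Icc δ (1 / 2) ×ˢ Set.Icc (-1) 1 with hS
  have hScomp : IsCompact S := isCompact_Icc.prod isCompact_Icc
  have hε1 : ε / 2 ∈ Set.Icc δ (1 / 2) := ⟨by rw [hδ]; nlinarith, by linarith⟩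
  have hx1 : ((ε / 2, 0) : ℝ × ℝ) ∈ S := ⟨hε1, by norm_num⟩
  have hPcont : Continuous fun q : ℝ × ℝ => PP ζ q.1 q.2 := by unfold PP; fun_prop
  have hcont : ContinuousOn Φ S := by
    have hu : ContinuousOn (fun q : ℝ × ℝ => u (PP ζ q.1 q.2)) S :=
      hus.continuousOn.comp hPcont.continuousOn
        (fun q hq => PP_mem ζ hζ _ _ (hδ0.trans_le hq.1.1) hq.1.2 hq.2.1 hq.2.2)
    have hlog : ContinuousOn (fun q : ℝ × ℝ => Real.log (2 * q.1)) S :=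
      ContinuousOn.log (by fun_prop) (fun q hq => by
        have := hδ0.trans_le hq.1.1
        positivity)
    have hin : Continuous (fun q : ℝ × ℝ => ⟪w, PP ζ q.1 q.2⟫) := continuous_const.inner hPcont
    simp only [hΦ, hh]
    refine (hu.sub hin.continuousOn).sub (ContinuousOn.add (Continuous.continuousOn (by fun_prop))
      (((Continuous.continuousOn (by fun_prop)).add (continuousOn_const.mul
        (continuous_fst.continuousOn.mul hlog))).add continuousOn_const))
  obtain ⟨⟨x, t⟩, hq, hmax⟩ := hScomp.exists_isMaxOn ⟨_, hx1⟩ hcont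
  have hx0 : 0 < x := hδ0.trans_le hq.1.1
  have hup' := hup x t hx0 hq.1.2 hq.2.1 hq.2.2
  have hle : Φ (x, t) ≤ 0 := by
    by_cases hxδ : x = δ
    · simp only [hΦ, hh]
      rw [hxδ] at hup' ⊢
      rw [hlogδ]
      have : 0 ≤ 4 * K * t ^ 2 * δ := by positivity
      linarith
    by_cases hxh : x = 1 / 2
    · simp only [hΦ, hh]
      rw [hxh] at hup' ⊢
      have : 0 ≤ 4 * K * t ^ 2 * (1 / 2) := by positivity
      have : 0 ≤ β * δ * (2 * N) := by positivity
      norm_num at *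
      linarith
    by_cases ht : t ^ 2 = 1
    · simp only [hΦ, hh]
      rw [ht]
      have : -(2 * N) ≤ Real.log (2 * x) := by
        rw [← hlogδ]
        exact Real.log_le_log (by positivity) (by linarith [hq.1.1])
      have : β * (x * (-(2 * N))) ≤ β * (x * Real.log (2 * x)) := by gcongr
      have : 0 ≤ β * δ * (2 * N) := by positivity
      have e : β * (x * (-(2 * N))) = - (4 * K * x) := by linear_combination (-2 * x) * hNβ
      linarith
    exfalso
    have hxI : x ∈ Set.Ioo δ (1 / 2) :=
      ⟨lt_of_le_of_ne hq.1.1 (Ne.symm hxδ), lt_of_le_of_ne hq.1.2 hxh⟩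
    have htI : t ∈ Set.Ioo (-1 : ℝ) 1 := by
      refine ⟨lt_of_le_of_ne hq.2.1 ?_, lt_of_le_of_ne hq.2.2 ?_⟩
      · rintro rfl; norm_num at ht
      · rintro rfl; norm_num at ht
    have hp := PP_mem ζ hζ x t hx0 hq.1.2 hq.2.1 hq.2.2
    have hloc : ∀ᶠ q in 𝓝 (x, t), Φ q ≤ Φ (x, t) := by
      have : S ∈ 𝓝 (x, t) := prod_mem_nhds (Icc_mem_nhds hxI.1 hxI.2) (Icc_mem_nhds htI.1 htI.2)
      filter_upwards [this] with q hq using hmax hq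
    have e1 : ∀ s, PP ζ x t + s • (-ζ + t • tau ζ) = PP ζ (x + s) t := by
      intro s; unfold PP; module
    have e2 : ∀ s : ℝ, PP ζ x t + s • (x • tau ζ) = PP ζ x (t + s) := by
      intro s; unfold PP; module
    have b1 : hess u (PP ζ x t) (-ζ + t • tau ζ) (-ζ + t • tau ζ) ≤ β / x := by
      refine second_order u hus w _ _ hp (fun s => m + 4 * K * t ^ 2 * (x + s) + h (x + s))
        (fun s => 4 * K * t ^ 2 + (K + β * (Real.log (2 * (x + s)) + 1))) _ ?_ ?_ ?_
      · have : ∀ᶠ s : ℝ in 𝓝 0, 0 < x + s := by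
          have : Tendsto (fun s : ℝ => x + s) (𝓝 0) (𝓝 (x + 0)) := by
            apply Continuous.tendsto; fun_prop
          exact this.eventually (lt_mem_nhds (by simpa using hx0))
        filter_upwards [this] with s hs
        have i1 : HasDerivAt (fun s => x + s) 1 s := (hasDerivAt_id s).const_add x
        have i2 := (i1.const_mul 2).log (by positivity)
        have := ((i1.const_mul (4 * K * t ^ 2)).const_add m).add
          (((i1.const_mul K).add ((i1.mul i2).const_mul β)).add_const (β * δ * (2 * N)))
        refine this.congr_deriv ?_
        field_simp
      · have i1 : HasDerivAt (fun s => x + s) 1 0 := (hasDerivAt_id (0:ℝ)).const_add x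
        have i2 := (i1.const_mul 2).log (by simp; positivity)
        have := (((i2.add_const 1).const_mul β).const_add K).const_add (4 * K * t ^ 2)
        refine this.congr_deriv ?_
        simp only [add_zero]
        field_simp
      · simp only [e1]
        have : Tendsto (fun s : ℝ => (x + s, t)) (𝓝 0) (𝓝 (x, t)) := by
          have : Continuous (fun s : ℝ => (x + s, t)) := by fun_prop
          simpa using this.tendsto 0
        filter_upwards [this.eventually hloc] with s hs
        simpa [hΦ] using hs
    have b2 : hess u (PP ζ x t) (x • tau ζ) (x • tau ζ) ≤ 8 * K * x := by
      refine second_order u hus w _ _ hp (fun s => m + 4 * K * (t + s) ^ 2 * x + h x)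
        (fun s => 4 * K * (2 * (t + s)) * x) _ ?_ ?_ ?_
      · refine Eventually.of_forall fun s => ?_
        have i1 : HasDerivAt (fun s => t + s) 1 s := (hasDerivAt_id s).const_add t
        have := ((((i1.pow 2).const_mul (4 * K)).mul_const x).const_add m).add_const (h x)
        refine this.congr_deriv ?_
        simp
      · have i1 : HasDerivAt (fun s => t + s) 1 0 := (hasDerivAt_id (0:ℝ)).const_add t
        have := ((i1.const_mul 2).const_mul (4 * K)).mul_const x
        refine this.congr_deriv ?_
        ring
      · simp only [e2]
        have : Tendsto (fun s : ℝ => (x, t + s)) (𝓝 0) (𝓝 (x, t)) := by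
          have : Continuous (fun s : ℝ => (x, t + s)) := by fun_prop
          simpa using this.tendsto 0
        filter_upwards [this.eventually hloc] with s hs
        simpa [hΦ] using hs
    have := interior_est ψ b hψ u hus huc hueq ζ hζ x t hx0 hq.1.2 hq.2.1 hq.2.2 _ _ b1 b2
    have e3 : β / x * (8 * K * x) = c / 2 := by
      field_simp
      linear_combination hβc
    rw [e3] at this
    linarith
  have h1 : Φ (ε / 2, 0) ≤ 0 := (hmax hx1).trans hle
  have h2 := hm _ (PP_mem ζ hζ (ε / 2) 0 (by positivity) hε1.2 (by norm_num) (by norm_num))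
  simp only [hΦ, hh] at h1
  have e4 : 2 * (ε / 2) = ε := by ring
  rw [e4, hlogε] at h1
  have e5 : K * (ε / 2) + β * (ε / 2 * -N) + β * δ * (2 * N) = K * ε / 2 * (4 * ε - 1) := by
    rw [hδ]; linear_combination (ε ^ 2 - ε / 2) * hNβ
  have e6 : K * ε / 2 * (4 * ε - 1) < 0 := mul_neg_of_pos_of_neg (by positivity) (by linarith)
  norm_num at h1
  norm_num at e5
  linarith

theorem bounded_solution_dual_surface_entire
    (ψ : E2 → ℝ) (b : ℝ)
    (hψs : ContDiffOn ℝ (⊤ : ℕ∞) ψ (ball (0 : E2) 1))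
    (hψ : ∀ z ∈ ball (0 : E2) 1, 0 < ψ z ∧ ψ z ≤ b)
    (u : E2 → ℝ)
    (hus : ContDiffOn ℝ (⊤ : ℕ∞) u (ball (0 : E2) 1))
    (huc : ConvexOn ℝ (ball (0 : E2) 1) u)
    (hub : ∃ M : ℝ, ∀ z ∈ ball (0 : E2) 1, |u z| ≤ M)
    (hueq : ∀ z ∈ ball (0 : E2) 1,
      detHess u z = (1 / ψ z) * ((1 - ‖z‖ ^ 2) ^ 2)⁻¹) :
    ∀ w : E2, ∃ z ∈ ball (0 : E2) 1, gradient u z = w := by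
  intro w
  obtain ⟨M, hM⟩ := hub
  set g : E2 → ℝ := fun z => u z - ⟪w, z⟫ with hg
  have hgb : ∀ z ∈ ball (0 : E2) 1, |g z| ≤ M + ‖w‖ := by
    intro z hz
    have h1 := hM z hz
    have h2 := abs_real_inner_le_norm w z
    have h3 : ‖z‖ ≤ 1 := (mem_ball_zero_iff.1 hz).le
    have h4 : ‖w‖ * ‖z‖ ≤ ‖w‖ := mul_le_of_le_one_right (norm_nonneg _) h3
    calc |g z| ≤ |u z| + |⟪w, z⟫| := abs_sub _ _
      _ ≤ _ := by linarith
  have hgc : ContinuousOn g (ball (0 : E2) 1) :=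
    hus.continuousOn.sub (by fun_prop)
  have hgconv : ConvexOn ℝ (ball (0 : E2) 1) g := by
    refine ⟨convex_ball _ _, fun x hx y hy a c ha hc hac => ?_⟩
    have := huc.2 hx hy ha hc hac
    simp only [hg, inner_add_right, inner_smul_right, smul_eq_mul] at this ⊢
    linarith
  set m := sInf (g '' ball (0 : E2) 1) with hm
  have hbdd : BddBelow (g '' ball (0 : E2) 1) := by
    refine ⟨-(M + ‖w‖), ?_⟩
    rintro _ ⟨z, hz, rfl⟩
    exact (abs_le.1 (hgb z hz)).1
  have hne : (g '' ball (0 : E2) 1).Nonempty := ⟨_, 0, by simp, rfl⟩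
  have hmle : ∀ z ∈ ball (0 : E2) 1, m ≤ g z := fun z hz => csInf_le hbdd ⟨z, hz, rfl⟩
  obtain ⟨y, -, hy, hys⟩ := exists_seq_tendsto_sInf hne hbdd
  choose z hz hzy using hys
  have hy' : Tendsto (fun n => g (z n)) atTop (𝓝 m) := by simpa [hzy] using hy
  obtain ⟨ζ, hζ, φ, hφ, hlim⟩ := (isCompact_closedBall (0 : E2) 1).tendsto_subseq
    (fun n => ball_subset_closedBall (hz n))
  have hgl : Tendsto (fun n => g (z (φ n))) atTop (𝓝 m) := hy'.comp hφ.tendsto_atTop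
  by_cases hζb : ζ ∈ ball (0 : E2) 1
  · refine ⟨ζ, hζb, ?_⟩
    have hnb := isOpen_ball.mem_nhds hζb
    have hgζ : g ζ = m :=
      tendsto_nhds_unique ((hgc.continuousAt hnb).tendsto.comp hlim) hgl
    have hmin : IsLocalMin g ζ := by
      filter_upwards [hnb] with x hx
      rw [hgζ]; exact hmle x hx
    have hd : DifferentiableAt ℝ u ζ := (hus.contDiffAt hnb).differentiableAt (by simp)
    have hdg : HasFDerivAt g (fderiv ℝ u ζ - innerSL ℝ w) ζ :=
      hd.hasFDerivAt.sub (innerSL ℝ w).hasFDerivAt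
    have h0 := hmin.hasFDerivAt_eq_zero hdg
    have : HasGradientAt u w ζ := by
      rw [hasGradientAt_iff_hasFDerivAt]
      have e : (InnerProductSpace.toDual ℝ E2) w = fderiv ℝ u ζ := by
        rw [sub_eq_zero.1 h0]; rfl
      rw [e]; exact hd.hasFDerivAt
    exact this.gradient
  · exfalso
    have hζ1 : ‖ζ‖ = 1 := le_antisymm (by simpa using hζ) (by simpa using hζb)
    have hb : 0 < b := by
      obtain ⟨q1, q2⟩ := hψ 0 (by simp)
      linarith
    set C := M + ‖w‖ with hC
    have hC0 : 0 ≤ C := (abs_nonneg _).trans (hgb 0 (by simp))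
    have hmC : -C ≤ m := le_csInf hne (by
      rintro _ ⟨z, hz, rfl⟩
      exact (abs_le.1 (hgb z hz)).1)
    have hray : ∀ x t : ℝ, 0 < x → x ≤ 1 / 2 → -1 ≤ t → t ≤ 1 →
        g (PP ζ x t) ≤ m + 4 * C * x := by
      intro x t hx hx' ht ht'
      have hp := PP_mem ζ hζ1 (1 / 2) t (by norm_num) le_rfl ht ht'
      have hq := PP_mem ζ hζ1 x t hx hx' ht ht'
      have e : (1 - 2 * x) • ζ + (2 * x) • PP ζ (1 / 2) t = PP ζ x t := by
        unfold PP; module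
      have l1 : Tendsto (fun n => (1 - 2 * x) • z (φ n) + (2 * x) • PP ζ (1 / 2) t) atTop
          (𝓝 (PP ζ x t)) := by
        rw [← e]
        exact (hlim.const_smul _).add_const _
      have l2 := (hgc.continuousAt (isOpen_ball.mem_nhds hq)).tendsto.comp l1
      have l3 := (hgl.const_mul (1 - 2 * x)).add_const ((2 * x) * g (PP ζ (1 / 2) t))
      have h4 := le_of_tendsto_of_tendsto' l2 l3 (fun n => by
        have := hgconv.2 (hz (φ n)) hp (show 0 ≤ 1 - 2 * x by linarith)
          (show 0 ≤ 2 * x by linarith) (by ring)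
        simpa using this)
      have h5 := (abs_le.1 (hgb _ hp)).2
      have h6 : 2 * x * (g (PP ζ (1 / 2) t) - m) ≤ 2 * x * (2 * C) := by
        gcongr
        linarith
      linarith
    set c := 1 / (4 * b) with hc
    have hc0 : 0 < c := by positivity
    refine core ψ b hψ u hus huc hueq w ζ hζ1 m (4 * C + c + 1) (by positivity) ?_ hmle ?_
    · rw [← hc]; nlinarith [mul_nonneg hC0 hc0.le]
    · intro x t hx hx' ht ht'
      have := hray x t hx hx' ht ht'
      have h7 : 0 ≤ (c + 1) * x := by positivity
      simp only [hg] at this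
      linarith
end
end
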